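/- arXiv:1902.01381 — 2 statements merged into one kernel-verified Lean document; each statement's English description precedes it below -/
import Mathlib

section
/- Let m, n be positive integers, d = m + n, N a positive integer, and let μ be the G-invariant Borel probability measure on X_N = G/Γ_N. Then there exist constants c_1, c_2 > 0 and T_0 > 0 such that for all T ≥ T_0, c_1·e^{−(m+n)T} ≤ μ({x ∈ X_N : Δ(x) ≥ T}) ≤ c_2·e^{−(m+n)T}. -/
open Matrix MeasureTheory

section setup

variable (ι : Type*) [Fintype ι] [DecidableEq ι]

/-- `SL(ι, R)` acts on `ι → R` by matrix-vector multiplication. -/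
instance slVecAction (R : Type*) [CommRing R] :
    MulAction (Matrix.SpecialLinearGroup ι R) (ι → R) where
  smul g v := g.1.mulVec v
  one_smul v := show (1 : Matrix.SpecialLinearGroup ι R).1.mulVec v = v by simp
  mul_smul g h v := show (g * h).1.mulVec v = g.1.mulVec (h.1.mulVec v) by
    simp [Matrix.SpecialLinearGroup.coe_mul, Matrix.mulVec_mulVec]

/-- The congruence subgroup `{γ ∈ SL(ι,ℤ) : γ e ≡ e (mod N)}`, realized as the
preimage of the stabilizer of `e` under reduction `SL(ι,ℤ) → SL(ι, ZMod N)`. -/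
def congruenceStabilizer (N : ℕ) (e : ι → ZMod N) :
    Subgroup (Matrix.SpecialLinearGroup ι ℤ) :=
  (MulAction.stabilizer (Matrix.SpecialLinearGroup ι (ZMod N)) e).comap
    (Matrix.SpecialLinearGroup.map (Int.castRingHom (ZMod N)))

/-- The congruence subgroup `Γ_N ≤ SL(ι,ℝ)`: the image in `SL(ι,ℝ)` of
`{γ ∈ SL(ι,ℤ) : γ e ≡ e (mod N)}`. -/
def congruenceSubgroupR (N : ℕ) (e : ι → ZMod N) :
    Subgroup (Matrix.SpecialLinearGroup ι ℝ) :=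
  (congruenceStabilizer ι N e).map (Matrix.SpecialLinearGroup.map (Int.castRingHom ℝ))

instance : TopologicalSpace (Matrix.SpecialLinearGroup ι ℝ) :=
  inferInstanceAs (TopologicalSpace {A : Matrix ι ι ℝ // A.det = 1})

instance : MeasurableSpace (Matrix.SpecialLinearGroup ι ℝ) :=
  borel (Matrix.SpecialLinearGroup ι ℝ)

end setup

/-- The first standard basis vector `e₁` of `(ZMod N)^{m+n}`. -/
def stdE1Mod (m n N : ℕ) : Fin m ⊕ Fin n → ZMod N :=
  Sum.elim (fun i => if (i : ℕ) = 0 then 1 else 0) 0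

/-- The function `Δ(gΓ_N) = sup {log 1/‖h e₁‖ : h ∈ g Γ_N}` on `X_N`,
where `‖·‖` is the maximum norm on `ℝ^{m+n}`. -/
noncomputable def DeltaCusp (m n N : ℕ)
    (x : Matrix.SpecialLinearGroup (Fin m ⊕ Fin n) ℝ ⧸
      congruenceSubgroupR (Fin m ⊕ Fin n) N (stdE1Mod m n N)) : ℝ :=
  sSup {ρ : ℝ | ∃ h : Matrix.SpecialLinearGroup (Fin m ⊕ Fin n) ℝ,
    QuotientGroup.mk h = x ∧
    ρ = Real.log ‖h.1.mulVec (Sum.elim (fun i => if (i : ℕ) = 0 then (1:ℝ) else 0) 0)‖⁻¹}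

section FiberMeasure

open scoped ENNReal

variable {G : Type*} [Group G] [MeasurableSpace G] (Γ : Subgroup G)

/-- The counting measure on the coset `x ∈ G ⧸ Γ`, seen as a measure on `G`. -/
noncomputable def fiberMeasure (x : G ⧸ Γ) : Measure G :=
  Quotient.liftOn' x (fun g => Measure.sum fun γ : Γ => Measure.dirac (g * γ)) (by
    intro a b hab
    obtain ⟨γ, rfl⟩ : ∃ γ : Γ, b = a * γ := ⟨⟨_, QuotientGroup.leftRel_apply.1 hab⟩, by simp⟩
    ext s hs
    simp only [Measure.sum_apply _ hs]
    rw [← (Equiv.mulLeft γ).tsum_eq]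
    simp [mul_assoc])

theorem fiberMeasure_mk_apply (g : G) {s : Set G} (hs : MeasurableSet s) :
    fiberMeasure Γ (g : G ⧸ Γ) s = ∑' γ : Γ, s.indicator 1 (g * (γ : G)) := by
  change (Measure.sum fun γ : Γ => Measure.dirac (g * (γ : G))) s = _
  simp [Measure.sum_apply _ hs, Measure.dirac_apply' _ hs]

variable [MeasurableMul G]

theorem measurable_quotient_smul (g : G) : Measurable (fun x : G ⧸ Γ => g • x) :=
  measurable_from_quotient.2 <|
    (measurable_quotient_mk'' (s := QuotientGroup.leftRel Γ)).comp (measurable_const_mul g)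

theorem fiberMeasure_smul (g : G) (x : G ⧸ Γ) {s : Set G} (hs : MeasurableSet s) :
    fiberMeasure Γ (g • x) s = fiberMeasure Γ x ((g * ·) ⁻¹' s) := by
  induction x using QuotientGroup.induction_on with | H h => ?_
  change fiberMeasure Γ ((g * h : G) : G ⧸ Γ) s = _
  rw [fiberMeasure_mk_apply Γ _ hs, fiberMeasure_mk_apply Γ _ (measurable_const_mul g hs)]
  refine tsum_congr fun γ => ?_
  rw [mul_assoc]
  rfl

variable [Countable Γ]

theorem measurable_fiberMeasure : Measurable (fiberMeasure Γ) := by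
  refine Measure.measurable_of_measurable_coe _ fun s hs => ?_
  refine measurable_from_quotient.2 ?_
  have : ((fun x : G ⧸ Γ => fiberMeasure Γ x s) ∘ Quotient.mk'') =
      fun g : G => ∑' γ : Γ, s.indicator (1 : G → ℝ≥0∞) (g * (γ : G)) :=
    funext fun g => fiberMeasure_mk_apply Γ g hs
  rw [this]
  exact Measurable.tsum fun γ =>
    (measurable_one.indicator hs).comp (measurable_mul_const (γ : G))

/-- The lift to `G` of a measure on `G ⧸ Γ`. -/
noncomputable def liftMeasure (μ : Measure (G ⧸ Γ)) : Measure G := μ.bind (fiberMeasure Γ)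

theorem liftMeasure_apply (μ : Measure (G ⧸ Γ)) {s : Set G} (hs : MeasurableSet s) :
    liftMeasure Γ μ s = ∫⁻ x, fiberMeasure Γ x s ∂μ :=
  Measure.bind_apply hs (measurable_fiberMeasure Γ).aemeasurable

theorem isMulLeftInvariant_liftMeasure (μ : Measure (G ⧸ Γ))
    (hμ : ∀ g : G, Measure.map (fun x => g • x) μ = μ) :
    (liftMeasure Γ μ).IsMulLeftInvariant := by
  refine ⟨fun g => ?_⟩
  ext s hs
  rw [Measure.map_apply (measurable_const_mul g) hs,
    liftMeasure_apply Γ μ (measurable_const_mul g hs), liftMeasure_apply Γ μ hs]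
  nth_rewrite 2 [← hμ g]
  rw [lintegral_map (f := fun x => fiberMeasure Γ x s)
    (Measure.measurable_coe hs |>.comp (measurable_fiberMeasure Γ))
    (measurable_quotient_smul Γ g)]
  simp_rw [fiberMeasure_smul Γ g _ hs]

theorem measure_le_liftMeasure (μ : Measure (G ⧸ Γ)) {E : Set (G ⧸ Γ)} {F : Set G}
    (hF : MeasurableSet F) (h : ∀ x ∈ E, ∃ g ∈ F, (g : G ⧸ Γ) = x) :
    μ E ≤ liftMeasure Γ μ F := by
  rw [liftMeasure_apply Γ μ hF]
  have := mul_meas_ge_le_lintegral₀ (μ := μ)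
    (Measure.measurable_coe hF |>.comp (measurable_fiberMeasure Γ)).aemeasurable 1
  rw [one_mul] at this
  refine (measure_mono fun x hx => ?_).trans this
  obtain ⟨g, hg, rfl⟩ := h x hx
  change 1 ≤ fiberMeasure Γ (g : G ⧸ Γ) F
  rw [fiberMeasure_mk_apply Γ g hF]
  refine le_trans ?_ (ENNReal.le_tsum 1)
  simp [hg]

theorem liftMeasure_le (μ : Measure (G ⧸ Γ)) {E : Set (G ⧸ Γ)} {F S : Set G}
    (hF : MeasurableSet F) (hFE : ∀ g ∈ F, (g : G ⧸ Γ) ∈ E) (hS : S.Finite)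
    (h : ∀ g ∈ F, ∀ γ ∈ Γ, g * γ ∈ F → γ ∈ S) :
    liftMeasure Γ μ F ≤ S.ncard * μ E := by
  rw [liftMeasure_apply Γ μ hF]
  calc ∫⁻ x, fiberMeasure Γ x F ∂μ
      ≤ ∫⁻ x, E.indicator (fun _ => (S.ncard : ℝ≥0∞)) x ∂μ := ?_
    _ ≤ S.ncard * μ E := lintegral_indicator_const_le _ _
  refine lintegral_mono fun x => ?_
  by_cases hx : ∃ g ∈ F, (g : G ⧸ Γ) = x
  · obtain ⟨g, hg, rfl⟩ := hx
    rw [Set.indicator_of_mem (hFE g hg), fiberMeasure_mk_apply Γ g hF]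
    have hS' : {γ : Γ | (γ : G) ∈ S}.Finite := hS.preimage Subtype.val_injective.injOn
    have : ∀ γ : Γ, γ ∉ hS'.toFinset → F.indicator (1 : G → ℝ≥0∞) (g * (γ : G)) = 0 := by
      intro γ hγ
      refine Set.indicator_of_notMem (fun hm => hγ ?_) _
      simpa using h g hg γ γ.2 hm
    rw [tsum_eq_sum fun γ hγ => this γ hγ]
    refine (Finset.sum_le_card_nsmul _ _ (1 : ℝ≥0∞)
      fun γ _ => Set.indicator_le_self' (f := (1 : G → ℝ≥0∞)) (by simp) _).trans ?_
    rw [nsmul_eq_mul, mul_one, Nat.cast_le, ← Set.ncard_eq_toFinset_card _ hS']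
    exact Set.ncard_le_ncard_of_injOn Subtype.val (fun γ hγ => hγ)
      Subtype.val_injective.injOn hS
  · induction x using QuotientGroup.induction_on with | H g => ?_
    rw [fiberMeasure_mk_apply Γ g hF]
    refine le_of_eq_of_le ?_ zero_le
    refine ENNReal.tsum_eq_zero.2 fun γ => Set.indicator_of_notMem (fun hm => hx ⟨_, hm, ?_⟩) _
    simp

end FiberMeasure

section ConeMeasure

open scoped ENNReal

variable {ι : Type*} [Fintype ι] 

/-- The action of a matrix on each entry of a tuple of vectors. -/
def tupleMul (g : Matrix ι ι ℝ) (A : ι → ι → ℝ) : ι → ι → ℝ := fun j => g *ᵥ A j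

theorem of_tupleMul (g : Matrix ι ι ℝ) (A : ι → ι → ℝ) : of (tupleMul g A) = of A * gᵀ := by
  ext i j
  simp [tupleMul, mul_apply, mulVec, dotProduct, mul_comm]

variable [DecidableEq ι]

instance : BorelSpace (SpecialLinearGroup ι ℝ) := ⟨rfl⟩

instance : IsTopologicalGroup (SpecialLinearGroup ι ℝ) where
  continuous_inv := continuous_induced_rng.mpr continuous_induced_dom.matrix_adjugate
  continuous_mul := continuous_induced_rng.mpr <|
    (continuous_induced_dom.comp continuous_fst).mul (continuous_induced_dom.comp continuous_snd)

theorem isClosedEmbedding_slVal :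
    Topology.IsClosedEmbedding (Subtype.val : SpecialLinearGroup ι ℝ → Matrix ι ι ℝ) :=
  (isClosed_singleton.preimage continuous_id.matrix_det).isClosedEmbedding_subtypeVal

instance : SecondCountableTopology (SpecialLinearGroup ι ℝ) :=
  have : SecondCountableTopology (Matrix ι ι ℝ) :=
    inferInstanceAs (SecondCountableTopology (ι → ι → ℝ))
  isClosedEmbedding_slVal.isEmbedding.secondCountableTopology

instance : T2Space (SpecialLinearGroup ι ℝ) :=
  have : T2Space (Matrix ι ι ℝ) := inferInstanceAs (T2Space (ι → ι → ℝ))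
  isClosedEmbedding_slVal.isEmbedding.t2Space

instance : LocallyCompactSpace (SpecialLinearGroup ι ℝ) :=
  have : LocallyCompactSpace (Matrix ι ι ℝ) :=
    inferInstanceAs (LocallyCompactSpace (ι → ι → ℝ))
  isClosedEmbedding_slVal.locallyCompactSpace

theorem continuous_sl_apply (i j : ι) :
    Continuous fun g : SpecialLinearGroup ι ℝ => g.1 i j :=
  (continuous_subtype_val (p := fun A : Matrix ι ι ℝ => A.det = 1)).matrix_elem i j

theorem measurable_to_sl {α : Type*} [MeasurableSpace α] {f : α → SpecialLinearGroup ι ℝ}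
    (hf : ∀ i j, Measurable fun a => (f a).1 i j) : Measurable f := by
  have h : borel (SpecialLinearGroup ι ℝ) =
      MeasurableSpace.comap (fun g i j => g.1 i j)
        (inferInstanceAs (MeasurableSpace (ι → ι → ℝ))) := by
    have : BorelSpace (ι → ι → ℝ) := inferInstance
    rw [this.measurable_eq, ← borel_comap]
    rfl
  have h' : Measurable[_, MeasurableSpace.comap (fun g i j => g.1 i j)
      (inferInstanceAs (MeasurableSpace (ι → ι → ℝ)))] f :=
    measurable_comap_iff.2 <|
      measurable_pi_lambda _ fun i => measurable_pi_lambda _ fun j => hf i j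
  rw [← h] at h'
  exact h'

open Classical in
/-- Normalization of (the transpose of) a matrix of positive determinant to determinant one. -/
noncomputable def normalizeSL (A : ι → ι → ℝ) : SpecialLinearGroup ι ℝ :=
  if h : 0 < (of A).det ∧ Nonempty ι then
    ⟨((of A).det ^ (-(Fintype.card ι : ℝ)⁻¹)) • (of A)ᵀ, by
      have := h.2
      rw [det_smul, det_transpose, ← Real.rpow_natCast, ← Real.rpow_mul h.1.le, neg_mul,
        inv_mul_cancel₀ (by simp), Real.rpow_neg_one, inv_mul_cancel₀ h.1.ne']⟩
  else 1

theorem normalizeSL_apply [Nonempty ι] {A : ι → ι → ℝ} (h : 0 < (of A).det) (i j : ι) :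
    (normalizeSL A).1 i j = (of A).det ^ (-(Fintype.card ι : ℝ)⁻¹) * A j i := by
  simp [normalizeSL, h, ‹Nonempty ι›]

theorem measurable_det_of : Measurable fun A : ι → ι → ℝ => (of A).det := by
  have : Continuous fun A : ι → ι → ℝ => (of A).det := Continuous.matrix_det continuous_id
  exact this.measurable

theorem measurable_normalizeSL [Nonempty ι] :
    Measurable (normalizeSL : (ι → ι → ℝ) → SpecialLinearGroup ι ℝ) := by
  refine measurable_to_sl fun i j => ?_
  have : (fun A : ι → ι → ℝ => (normalizeSL A).1 i j) = fun A =>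
      if 0 < (of A).det then (of A).det ^ (-(Fintype.card ι : ℝ)⁻¹) * A j i
      else (1 : Matrix ι ι ℝ) i j := by
    funext A
    split_ifs with h
    · exact normalizeSL_apply h i j
    · simp [normalizeSL, h]
  rw [this]
  refine Measurable.ite (measurableSet_lt measurable_const measurable_det_of) ?_ measurable_const
  exact (measurable_det_of.pow_const _).mul ((measurable_pi_apply i).comp (measurable_pi_apply j))

theorem measurePreserving_mulVec {g : Matrix ι ι ℝ} (hg : |g.det| = 1) :
    MeasurePreserving (fun v : ι → ℝ => g *ᵥ v) volume volume := by
  refine ⟨(Continuous.matrix_mulVec continuous_const continuous_id).measurable, ?_⟩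
  have h0 : g.det ≠ 0 := fun h => by simp [h] at hg
  have := Real.map_matrix_volume_pi_eq_smul_volume_pi h0
  rw [abs_inv, hg] at this
  rw [inv_one, ENNReal.ofReal_one, one_smul] at this
  exact this

theorem measurePreserving_tupleMul {g : Matrix ι ι ℝ} (hg : |g.det| = 1) :
    MeasurePreserving (tupleMul g) volume volume :=
  volume_preserving_pi fun _ => measurePreserving_mulVec hg

theorem normalizeSL_tupleMul (g : SpecialLinearGroup ι ℝ) {A : ι → ι → ℝ} [Nonempty ι]
    (hA : 0 < (of A).det) : normalizeSL (tupleMul g.1 A) = g * normalizeSL A := by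
  have hd : (of (tupleMul g.1 A)).det = (of A).det := by
    simp [of_tupleMul, det_transpose]
  ext i j
  rw [normalizeSL_apply (by rwa [hd]), hd]
  change _ = (g.1 * (normalizeSL A).1) i j
  rw [mul_apply]
  simp only [normalizeSL_apply hA]
  simp only [tupleMul, mulVec, dotProduct, Finset.mul_sum]
  exact Finset.sum_congr rfl fun k _ => by ring

/-- The cone measure on `SL(ι, ℝ)`. -/
noncomputable def coneMeasure (ι : Type*) [Fintype ι] [DecidableEq ι] :
    Measure (SpecialLinearGroup ι ℝ) :=
  (volume.restrict {A : ι → ι → ℝ | (of A).det ∈ Set.Ioc 0 1}).map normalizeSL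

theorem measurableSet_det_mem {I : Set ℝ} (hI : MeasurableSet I) :
    MeasurableSet {A : ι → ι → ℝ | (of A).det ∈ I} := measurable_det_of hI

theorem coneMeasure_apply [Nonempty ι] {s : Set (SpecialLinearGroup ι ℝ)} (hs : MeasurableSet s) :
    coneMeasure ι s = volume {A : ι → ι → ℝ | normalizeSL A ∈ s ∧ (of A).det ∈ Set.Ioc 0 1} := by
  rw [coneMeasure, Measure.map_apply measurable_normalizeSL hs,
    Measure.restrict_apply (measurable_normalizeSL hs)]
  rfl

instance [Nonempty ι] : (coneMeasure ι).IsMulLeftInvariant := by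
  refine ⟨fun g => ?_⟩
  ext s hs
  have hg : |g.1.det| = 1 := by simp
  rw [Measure.map_apply (measurable_const_mul g) hs, coneMeasure_apply hs,
    coneMeasure_apply (measurable_const_mul g hs),
    ← (measurePreserving_tupleMul hg).measure_preimage (s := 
      {A | normalizeSL A ∈ s ∧ (of A).det ∈ Set.Ioc 0 1})
      ((measurable_normalizeSL hs).inter
        (measurableSet_det_mem measurableSet_Ioc)).nullMeasurableSet]
  congr 1
  ext A
  have hd : (of (tupleMul g.1 A)).det = (of A).det := by
    simp [of_tupleMul, det_transpose]
  simp only [Set.mem_preimage, Set.mem_ofPred_eq, hd]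
  refine and_congr_left fun h => ?_
  rw [normalizeSL_tupleMul g h.1]

theorem coneMeasure_compact_lt_top [Nonempty ι] {K : Set (SpecialLinearGroup ι ℝ)}
    (hK : IsCompact K) : coneMeasure ι K < ∞ := by
  obtain ⟨R, hR⟩ : ∃ R, ∀ g ∈ K, ∀ i j, |g.1 i j| ≤ R := by
    have h : ∀ i j, ∃ R, ∀ g ∈ K, |g.1 i j| ≤ R := fun i j => by
      obtain ⟨R, hR⟩ := hK.exists_bound_of_continuousOn (continuous_sl_apply i j).continuousOn
      exact ⟨R, hR⟩
    choose R hR using h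
    refine ⟨∑ i, ∑ j, |R i j|, fun g hg i j => (hR i j g hg).trans ?_⟩
    exact (le_abs_self _).trans <| (Finset.single_le_sum (f := fun j => |R i j|)
      (fun _ _ => abs_nonneg _) (Finset.mem_univ j)).trans <|
      Finset.single_le_sum (f := fun i => ∑ j, |R i j|)
      (fun _ _ => Finset.sum_nonneg fun _ _ => abs_nonneg _) (Finset.mem_univ i)
  rw [coneMeasure_apply hK.measurableSet]
  refine lt_of_le_of_lt (measure_mono ?_)
    (isCompact_univ_pi fun _ : ι => isCompact_univ_pi fun _ : ι =>
      isCompact_Icc (a := -R) (b := R)).measure_lt_top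
  rintro A ⟨hA, hd⟩
  intro i _ j _
  have := hR _ hA j i
  rw [normalizeSL_apply hd.1] at this
  have h1 : 1 ≤ (of A).det ^ (-(Fintype.card ι : ℝ)⁻¹) :=
    Real.one_le_rpow_of_pos_of_le_one_of_nonpos hd.1 hd.2 (by simp)
  rw [Set.mem_Icc, ← abs_le]
  rw [abs_mul, abs_of_pos (by linarith)] at this
  exact (le_mul_of_one_le_left (abs_nonneg _) h1).trans this

theorem coneMeasure_ne_zero [Nonempty ι] : coneMeasure ι Set.univ ≠ 0 := by
  rw [coneMeasure_apply MeasurableSet.univ]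
  have ho : IsOpen {A : ι → ι → ℝ | (of A).det ∈ Set.Ioo 0 1} :=
    isOpen_Ioo.preimage (Continuous.matrix_det (A := fun A : ι → ι → ℝ => of A) continuous_id)
  have hn : {A : ι → ι → ℝ | (of A).det ∈ Set.Ioo 0 1}.Nonempty := by
    refine ⟨of.symm ((1 / 2 : ℝ) • 1), ?_⟩
    have : ((1 / 2 : ℝ) ^ Fintype.card ι) < 1 := pow_lt_one₀ (by norm_num) (by norm_num) (by simp)
    simp only [Set.mem_ofPred_eq, Equiv.apply_symm_apply, det_smul, det_one, mul_one]
    exact ⟨by positivity, this⟩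
  refine ((ho.measure_pos volume hn).trans_le (measure_mono ?_)).ne'
  exact fun A hA => ⟨trivial, hA.1, hA.2.le⟩

theorem coneMeasure_isHaar [Nonempty ι] : (coneMeasure ι).IsHaarMeasure := by
  have : IsFiniteMeasureOnCompacts (coneMeasure ι) := ⟨fun _ => coneMeasure_compact_lt_top⟩
  have : NeZero (coneMeasure ι) := ⟨fun h => coneMeasure_ne_zero (by rw [h]; rfl)⟩
  have : (coneMeasure ι).IsOpenPosMeasure := isOpenPosMeasure_of_mulLeftInvariant_of_regular
  exact {}

end ConeMeasure

section Blocks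

open scoped ENNReal

variable {κ : Type*}

/-- For a tuple `A` of vectors, the images of all but the first one modulo the line spanned by the
first one, in the coordinates complementary to the first coordinate. -/
noncomputable def quotTuple (A : Unit ⊕ κ → Unit ⊕ κ → ℝ) : κ → κ → ℝ := fun i j =>
  A (.inr i) (.inr j) - A (.inr i) (.inl ()) * A (.inl ()) (.inr j) / A (.inl ()) (.inl ())

/-- Tuples whose first vector lies in `S`, whose other vectors have reduced first coordinate,
and whose quotient tuple lies in `Q`. -/
def blockSet (S : Set (Unit ⊕ κ → ℝ)) (Q : Set (κ → κ → ℝ)) :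
    Set (Unit ⊕ κ → Unit ⊕ κ → ℝ) :=
  {A | A (.inl ()) ∈ S ∧ (∀ i, |A (.inr i) (.inl ())| ≤ |A (.inl ()) (.inl ())| / 2) ∧
    quotTuple A ∈ Q}

theorem measurable_quotTuple :
    Measurable (quotTuple : (Unit ⊕ κ → Unit ⊕ κ → ℝ) → κ → κ → ℝ) := by
  unfold quotTuple
  fun_prop

variable [Fintype κ]

theorem measurableSet_blockSet {S : Set (Unit ⊕ κ → ℝ)} {Q : Set (κ → κ → ℝ)}
    (hS : MeasurableSet S) (hQ : MeasurableSet Q) : MeasurableSet (blockSet S Q) := by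
  have h1 : Measurable fun A : Unit ⊕ κ → Unit ⊕ κ → ℝ => A (.inl ()) := measurable_pi_apply _
  have h2 : MeasurableSet {A : Unit ⊕ κ → Unit ⊕ κ → ℝ |
      ∀ i, |A (.inr i) (.inl ())| ≤ |A (.inl ()) (.inl ())| / 2} := by
    rw [Set.ofPred_forall]
    exact MeasurableSet.iInter fun i => measurableSet_le (by fun_prop) (by fun_prop)
  exact (h1 hS).inter (h2.inter (measurable_quotTuple hQ))

variable [DecidableEq κ]

theorem det_eq_mul_det_quotTuple {A : Unit ⊕ κ → Unit ⊕ κ → ℝ}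
    (hA : A (.inl ()) (.inl ()) ≠ 0) :
    (of A).det = A (.inl ()) (.inl ()) * (of (quotTuple A)).det := by
  have hinv : IsUnit (of A).toBlocks₁₁ := by
    rw [isUnit_iff_isUnit_det, det_unique]
    exact isUnit_iff_ne_zero.2 hA
  let := hinv.invertible
  rw [← fromBlocks_toBlocks (of A), det_fromBlocks₁₁, det_unique]
  congr 2
  ext i j
  rw [invOf_eq_nonsing_inv, inv_subsingleton]
  simp [mul_apply, quotTuple, toBlocks₁₁, toBlocks₁₂, toBlocks₂₁, toBlocks₂₂, diagonal]
  ring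

theorem volume_cone_smul_det [Nonempty κ] {Q : Set (κ → κ → ℝ)}
    (hcone : ∀ t : ℝ, 0 < t → ∀ A ∈ Q, t • A ∈ Q) (I : Set ℝ) {a : ℝ} (ha : a ≠ 0) :
    volume {A : κ → κ → ℝ | A ∈ Q ∧ |a * (of A).det| ∈ I} =
      ENNReal.ofReal (|a| ^ Fintype.card κ)⁻¹ *
        volume {A : κ → κ → ℝ | A ∈ Q ∧ |(of A).det| ∈ I} := by
  have ha' : 0 < |a| := abs_pos.2 ha
  set t : ℝ := |a| ^ ((Fintype.card κ : ℝ)⁻¹) with ht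
  have htp : 0 < t := Real.rpow_pos_of_pos ha' _
  have htk : t ^ Fintype.card κ = |a| := by
    rw [ht, ← Real.rpow_natCast, ← Real.rpow_mul ha'.le, inv_mul_cancel₀ (by simp), Real.rpow_one]
  have hset : {A : κ → κ → ℝ | A ∈ Q ∧ |a * (of A).det| ∈ I} =
      (t • ·) ⁻¹' {A : κ → κ → ℝ | A ∈ Q ∧ |(of A).det| ∈ I} := by
    ext A
    have h1 : t • A ∈ Q ↔ A ∈ Q := by
      refine ⟨fun h => ?_, hcone t htp A⟩
      have := hcone t⁻¹ (inv_pos.2 htp) _ h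
      rwa [smul_smul, inv_mul_cancel₀ htp.ne', one_smul] at this
    have h2 : (of (t • A)).det = |a| * (of A).det := by
      rw [← htk, ← det_smul]; rfl
    simp only [Set.mem_preimage, Set.mem_ofPred_eq, h1, h2, abs_mul, abs_abs]
  rw [hset, Measure.addHaar_preimage_smul _ htp.ne']
  congr 2
  have : Module.finrank ℝ (κ → κ → ℝ) = Fintype.card κ * Fintype.card κ := by
    simp [Module.finrank_pi_fintype]
  rw [this, pow_mul, htk, abs_of_pos (by positivity)]

/-- The volume of a set of tuples described through the first vector and the quotient tuple. -/
theorem volume_blockSet [Nonempty κ] {S : Set (Unit ⊕ κ → ℝ)} {Q : Set (κ → κ → ℝ)} {I : Set ℝ}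
    (hS : MeasurableSet S) (hS0 : ∀ b ∈ S, b (.inl ()) ≠ 0) (hQ : MeasurableSet Q)
    (hcone : ∀ t : ℝ, 0 < t → ∀ A ∈ Q, t • A ∈ Q) (hI : MeasurableSet I) :
    volume {A : Unit ⊕ κ → Unit ⊕ κ → ℝ | A ∈ blockSet S Q ∧ |(of A).det| ∈ I} =
      volume S * volume {A : κ → κ → ℝ | A ∈ Q ∧ |(of A).det| ∈ I} := by
  set V := volume {A : κ → κ → ℝ | A ∈ Q ∧ |(of A).det| ∈ I} with hV
  have hdet : MeasurableSet {A : Unit ⊕ κ → Unit ⊕ κ → ℝ | |(of A).det| ∈ I} :=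
    (measurable_det_of.abs) hI
  -- split off the first vector
  let e₁ : (Unit ⊕ κ → Unit ⊕ κ → ℝ) ≃ᵐ (Unit → Unit ⊕ κ → ℝ) × (κ → Unit ⊕ κ → ℝ) :=
    MeasurableEquiv.sumPiEquivProdPi _
  have he₁ : MeasurePreserving e₁ volume volume :=
    volume_measurePreserving_sumPiEquivProdPi (fun _ : Unit ⊕ κ => Unit ⊕ κ → ℝ)
  have hu : MeasurePreserving (MeasurableEquiv.funUnique Unit (Unit ⊕ κ → ℝ)) volume volume :=
    volume_preserving_funUnique _ _
  have hm := (measurableSet_blockSet hS hQ).inter hdet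
  change volume (blockSet S Q ∩ {A : Unit ⊕ κ → Unit ⊕ κ → ℝ | |(of A).det| ∈ I}) = _
  rw [← (he₁.symm e₁).measure_preimage hm.nullMeasurableSet, Measure.volume_eq_prod,
    Measure.prod_apply (e₁.symm.measurable hm),
    ← hu.symm _ |>.lintegral_comp_emb (MeasurableEquiv.measurableEmbedding _)]
  have key : ∀ b : Unit ⊕ κ → ℝ, volume (Prod.mk ((MeasurableEquiv.funUnique Unit _).symm b) ⁻¹'
      (e₁.symm ⁻¹' (blockSet S Q ∩ {A : Unit ⊕ κ → Unit ⊕ κ → ℝ | |(of A).det| ∈ I}))) =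
      S.indicator (fun _ => V) b := by
    intro b
    by_cases hb : b ∈ S
    swap
    · rw [Set.indicator_of_notMem hb]
      convert! measure_empty (μ := volume)
      refine Set.eq_empty_of_forall_notMem fun R hR => hb hR.1.1
    rw [Set.indicator_of_mem hb]
    set a := b (.inl ()) with ha
    have ha0 : a ≠ 0 := hS0 b hb
    let e₂ : (κ → Unit ⊕ κ → ℝ) ≃ᵐ (κ → (Unit → ℝ) × (κ → ℝ)) :=
      MeasurableEquiv.piCongrRight fun _ => MeasurableEquiv.sumPiEquivProdPi _
    have he₂ : MeasurePreserving e₂ volume volume :=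
      volume_preserving_pi fun _ =>
        volume_measurePreserving_sumPiEquivProdPi (fun _ : Unit ⊕ κ => ℝ)
    let e₃ := MeasurableEquiv.arrowProdEquivProdArrow (Unit → ℝ) (κ → ℝ) κ
    have he₃ : MeasurePreserving e₃ volume volume :=
      volume_measurePreserving_arrowProdEquivProdArrow _ _ _
    have he := ((he₂.trans he₃).symm (e₂.trans e₃))
    have hmb := measurable_prodMk_left (x := (MeasurableEquiv.funUnique Unit _).symm b)
      (e₁.symm.measurable hm)
    rw [← he.measure_preimage hmb.nullMeasurableSet, Measure.volume_eq_prod,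
      Measure.prod_apply ((e₂.trans e₃).symm.measurable hmb)]
    let box : Set (κ → Unit → ℝ) := Set.univ.pi fun _ => Set.univ.pi fun _ =>
      Set.Icc (-(|a| / 2)) (|a| / 2)
    have hbox : volume box = ENNReal.ofReal (|a| ^ Fintype.card κ) := by
      simp only [box, volume_pi_pi, Real.volume_Icc]
      simp [ENNReal.ofReal_pow]
    have key2 : ∀ r : κ → Unit → ℝ, volume (Prod.mk r ⁻¹' ((e₂.trans e₃).symm ⁻¹'
        (Prod.mk ((MeasurableEquiv.funUnique Unit _).symm b) ⁻¹' (e₁.symm ⁻¹' (blockSet S Q ∩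
          {A : Unit ⊕ κ → Unit ⊕ κ → ℝ | |(of A).det| ∈ I}))))) =
        box.indicator (fun _ => ENNReal.ofReal (|a| ^ Fintype.card κ)⁻¹ * V) r := by
      intro r
      by_cases hr : r ∈ box
      · rw [Set.indicator_of_mem hr, hV, ← volume_cone_smul_det hcone I ha0,
          ← measure_preimage_add_right volume (-fun i j => r i () * b (.inr j) / a)
            {A : κ → κ → ℝ | A ∈ Q ∧ |a * (of A).det| ∈ I}]
        congr 1
        ext D
        simp only [Set.mem_preimage, ← sub_eq_add_neg]
        set A := e₁.symm ((MeasurableEquiv.funUnique Unit _).symm b, (e₂.trans e₃).symm (r, D))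
        have h1 : A (.inl ()) = b := rfl
        have h2 : quotTuple A = D - (fun i j => r i () * b (.inr j) / a) := rfl
        have h3 := det_eq_mul_det_quotTuple (A := A) ha0
        change (A (.inl ()) ∈ S ∧ (∀ i, |r i ()| ≤ |a| / 2) ∧ quotTuple A ∈ Q) ∧
          |(of A).det| ∈ I ↔ D - (fun i j => r i () * b (.inr j) / a) ∈ Q ∧
            |a * (of (D - (fun i j => r i () * b (.inr j) / a))).det| ∈ I
        rw [h3, h2, h1]
        have : ∀ i, |r i ()| ≤ |a| / 2 := fun i => abs_le.2 (hr i trivial () trivial)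
        tauto
      · rw [Set.indicator_of_notMem hr]
        convert! measure_empty (μ := volume)
        refine Set.eq_empty_of_forall_notMem fun D hD => hr ?_
        intro i _ j _
        exact abs_le.1 (hD.1.2.1 i)
    simp_rw [key2]
    have hboxm : MeasurableSet box :=
      MeasurableSet.univ_pi fun _ => MeasurableSet.univ_pi fun _ => measurableSet_Icc
    rw [lintegral_indicator hboxm, setLIntegral_const, hbox, mul_right_comm,
      ← ENNReal.ofReal_mul (by positivity), inv_mul_cancel₀ (by positivity), ENNReal.ofReal_one,
      one_mul]
  simp_rw [key]
  rw [lintegral_indicator hS, setLIntegral_const, mul_comm]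

end Blocks

section IntegerCombinations

variable {ι : Type*} [Fintype ι]

/-- Integer combinations of a tuple of vectors, with the coefficients given by a matrix. -/
def intMul (γ : Matrix ι ι ℤ) (A : ι → ι → ℝ) : ι → ι → ℝ := fun i j => ∑ k, (γ i k : ℝ) * A k j

theorem of_intMul (γ : Matrix ι ι ℤ) (A : ι → ι → ℝ) :
    of (intMul γ A) = γ.map (Int.castRingHom ℝ) * of A := by
  ext i j
  simp [intMul, mul_apply]

theorem intMul_apply (γ : Matrix ι ι ℤ) (A : ι → ι → ℝ) (i : ι) :
    intMul γ A i = (fun k => (γ i k : ℝ)) ᵥ* of A := by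
  ext j
  simp [intMul, vecMul, dotProduct]

theorem intMul_mul (γ γ' : Matrix ι ι ℤ) (A : ι → ι → ℝ) :
    intMul (γ * γ') A = intMul γ (intMul γ' A) := by
  apply of.injective
  rw [of_intMul, of_intMul, of_intMul, Matrix.map_mul, Matrix.mul_assoc]

theorem measurePreserving_reindex {ι' : Type*} [Fintype ι'] (σ τ : ι ≃ ι') :
    MeasurePreserving (fun (A : ι' → ι' → ℝ) i j => A (σ i) (τ j)) volume volume := by
  have h (τ : ι ≃ ι') {E : Type} [MeasureSpace E] [SigmaFinite (volume : Measure E)] :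
      MeasurePreserving (fun (A : ι' → E) i => A (τ i)) volume volume :=
    measurePreserving_arrowCongr' (fun _ => volume) (fun _ => volume) τ.symm
      (MeasurableEquiv.refl E) fun _ => MeasurePreserving.id _
  have h1 : MeasurePreserving (fun (A : ι' → ι' → ℝ) i => A (σ i)) volume volume :=
    measurePreserving_arrowCongr' (fun _ => volume) (fun _ => volume) σ.symm
      (MeasurableEquiv.refl (ι' → ℝ)) fun _ => MeasurePreserving.id _
  exact (volume_preserving_pi fun _ => h τ).comp h1

variable [DecidableEq ι]

theorem det_intMul (γ : SpecialLinearGroup ι ℤ) (A : ι → ι → ℝ) :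
    (of (intMul γ.1 A)).det = (of A).det := by
  have : (γ.1.map (Int.castRingHom ℝ)).det = 1 := by
    rw [← RingHom.mapMatrix_apply, ← RingHom.map_det, γ.2, map_one]
  rw [of_intMul, det_mul, this, one_mul]

theorem intMul_coe_mul (γ γ' : SpecialLinearGroup ι ℤ) (A : ι → ι → ℝ) :
    intMul (γ * γ').1 A = intMul γ.1 (intMul γ'.1 A) :=
  intMul_mul _ _ _

/-- Nonzero integer combinations of linearly independent vectors are bounded away from zero. -/
theorem exists_le_norm_vecMul {A : ι → ι → ℝ} (hA : (of A).det ≠ 0) :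
    ∃ c : ℝ, 0 < c ∧ ∀ v : ι → ℤ, v ≠ 0 → c ≤ ‖(fun k => (v k : ℝ)) ᵥ* of A‖ := by
  let L := LinearMap.toContinuousLinearMap ((of A)⁻¹.vecMulLinear)
  refine ⟨(‖L‖ + 1)⁻¹, by positivity, fun v hv => ?_⟩
  set w := (fun k => (v k : ℝ)) ᵥ* of A with hw
  have h1 : L w = fun k => (v k : ℝ) := by
    change w ᵥ* (of A)⁻¹ = _
    rw [hw, vecMul_vecMul, mul_nonsing_inv _ (isUnit_iff_ne_zero.2 hA), vecMul_one]
  obtain ⟨i, hi⟩ := Function.ne_iff.1 hv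
  have h2 : (1 : ℝ) ≤ ‖L w‖ := by
    rw [h1]
    refine le_trans ?_ (norm_le_pi_norm _ i)
    rw [Real.norm_eq_abs]
    exact_mod_cast Int.one_le_abs hi
  have h3 := L.le_opNorm w
  rw [inv_le_iff_one_le_mul₀ (by positivity)]
  nlinarith [norm_nonneg w]

theorem exists_le_norm_intMul {A : ι → ι → ℝ} (hA : (of A).det ≠ 0) :
    ∃ c : ℝ, 0 < c ∧ ∀ (γ : SpecialLinearGroup ι ℤ) (i : ι), c ≤ ‖intMul γ.1 A i‖ := by
  obtain ⟨c, hc, h⟩ := exists_le_norm_vecMul hA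
  refine ⟨c, hc, fun γ i => ?_⟩
  rw [intMul_apply]
  refine h _ fun h0 => ?_
  have := det_eq_zero_of_row_eq_zero (A := γ.1) i (fun j => congrFun h0 j)
  rw [γ.2] at this
  exact one_ne_zero this

end IntegerCombinations

section LowerBlocks

variable {κ : Type*} [Fintype κ] [DecidableEq κ]

/-- The block lower triangular integer matrix with diagonal blocks `1`, `γ` and first column `s`. -/
def lowerSL (s : κ → ℤ) (γ : SpecialLinearGroup κ ℤ) : SpecialLinearGroup (Unit ⊕ κ) ℤ :=
  ⟨fromBlocks 1 0 (of fun i _ => s i) γ.1, by simp⟩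

theorem intMul_lowerSL_inl (s : κ → ℤ) (γ : SpecialLinearGroup κ ℤ)
    (A : Unit ⊕ κ → Unit ⊕ κ → ℝ) : intMul (lowerSL s γ).1 A (.inl ()) = A (.inl ()) := by
  ext j
  simp [intMul, lowerSL]

theorem intMul_lowerSL_inr (s : κ → ℤ) (γ : SpecialLinearGroup κ ℤ)
    (A : Unit ⊕ κ → Unit ⊕ κ → ℝ) (i : κ) (j : Unit ⊕ κ) :
    intMul (lowerSL s γ).1 A (.inr i) j =
      s i * A (.inl ()) j + ∑ k, (γ.1 i k : ℝ) * A (.inr k) j := by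
  simp [intMul, lowerSL]

theorem quotTuple_intMul_lowerSL (s : κ → ℤ) (γ : SpecialLinearGroup κ ℤ)
    {A : Unit ⊕ κ → Unit ⊕ κ → ℝ} (hA : A (.inl ()) (.inl ()) ≠ 0) :
    quotTuple (intMul (lowerSL s γ).1 A) = intMul γ.1 (quotTuple A) := by
  ext i j
  simp only [quotTuple, intMul_lowerSL_inl, intMul_lowerSL_inr]
  simp only [intMul, quotTuple, mul_sub, Finset.sum_sub_distrib]
  rw [add_mul, add_div, Finset.sum_mul, Finset.sum_div, mul_right_comm,
    mul_div_cancel_right₀ _ hA]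
  simp only [mul_assoc, mul_div_assoc]
  ring

/-- If every tuple can be moved into `S`, then every tuple can be reduced modulo its first
vector. -/
theorem exists_lowerSL {S : Set (κ → κ → ℝ)}
    (hS : ∀ A : κ → κ → ℝ, (of A).det ≠ 0 → ∃ γ : SpecialLinearGroup κ ℤ, intMul γ.1 A ∈ S)
    {A : Unit ⊕ κ → Unit ⊕ κ → ℝ} (hA : (of A).det ≠ 0) (ha : A (.inl ()) (.inl ()) ≠ 0) :
    ∃ s γ, (∀ i, |intMul (lowerSL s γ).1 A (.inr i) (.inl ())| ≤ |A (.inl ()) (.inl ())| / 2) ∧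
      quotTuple (intMul (lowerSL s γ).1 A) ∈ S := by
  have hq : (of (quotTuple A)).det ≠ 0 := by
    rw [det_eq_mul_det_quotTuple ha] at hA
    exact right_ne_zero_of_mul hA
  obtain ⟨γ, hγ⟩ := hS _ hq
  set a := A (.inl ()) (.inl ()) with ha'
  set r : κ → ℝ := fun i => ∑ k, (γ.1 i k : ℝ) * A (.inr k) (.inl ()) with hr
  refine ⟨fun i => -round (r i / a), γ, fun i => ?_, ?_⟩
  · have h1 := abs_sub_round (r i / a)
    have h2 : intMul (lowerSL (fun i => -round (r i / a)) γ).1 A (.inr i) (.inl ()) =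
        (r i / a - round (r i / a)) * a := by
      rw [intMul_lowerSL_inr, sub_mul, div_mul_cancel₀ _ ha]
      simp only [hr, ← ha']
      push_cast
      ring
    rw [h2, abs_mul]
    nlinarith [abs_nonneg a]
  · rwa [quotTuple_intMul_lowerSL _ _ ha]

end LowerBlocks

section Reduction

open scoped ENNReal

/-- Existence of a measurable cone of tuples, meeting every orbit of integer unimodular
combinations, of finite volume for bounded determinant, and containing a short vector at a fixed
index. -/
def HasReduction (ι : Type*) [Fintype ι] [DecidableEq ι] : Prop :=
  ∃ (i₀ : ι) (S : Set (ι → ι → ℝ)) (C : ℝ), MeasurableSet S ∧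
    (∀ t : ℝ, 0 < t → ∀ A ∈ S, t • A ∈ S) ∧
    (∀ A : ι → ι → ℝ, (of A).det ≠ 0 → ∃ γ : SpecialLinearGroup ι ℤ, intMul γ.1 A ∈ S) ∧
    volume {A : ι → ι → ℝ | A ∈ S ∧ |(of A).det| ∈ Set.Ioc 0 1} < ∞ ∧
    ∀ A ∈ S, ‖A i₀‖ ^ Fintype.card ι ≤ C * |(of A).det|

theorem hasReduction_fin_one : HasReduction (Fin 1) := by
  refine ⟨0, Set.univ, 1, MeasurableSet.univ, fun _ _ _ _ => trivial,
    fun A _ => ⟨1, trivial⟩, ?_, fun A _ => ?_⟩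
  · refine (measure_mono (t := Metric.closedBall 0 1) fun A hA => ?_).trans_lt
      (isCompact_closedBall _ _).measure_lt_top
    have h := hA.2.2
    simp only [det_unique, Fin.default_eq_zero, of_apply] at h
    rw [mem_closedBall_zero_iff, pi_norm_le_iff_of_nonneg zero_le_one]
    intro i
    rw [pi_norm_le_iff_of_nonneg zero_le_one]
    intro j
    rw [Subsingleton.elim i 0, Subsingleton.elim j 0]
    exact h
  · simp only [Fintype.card_fin, pow_one, one_mul, det_unique, Fin.default_eq_zero, of_apply]
    rw [pi_norm_le_iff_of_nonneg (abs_nonneg _)]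
    intro j
    rw [Subsingleton.elim j 0, Real.norm_eq_abs]

variable {ι ι' : Type*} [Fintype ι] [DecidableEq ι] [Fintype ι'] [DecidableEq ι']

theorem abs_det_permute (σ τ : ι ≃ ι') (A : ι' → ι' → ℝ) :
    |(of fun i j => A (σ i) (τ j)).det| = |(of A).det| :=
  abs_det_submatrix_equiv_equiv σ τ (of A)

theorem HasReduction.equiv (h : HasReduction ι) (e : ι ≃ ι') : HasReduction ι' := by
  obtain ⟨i₀, S, C, hSm, hSt, hS, hSv, hSC⟩ := h
  have hp := measurePreserving_reindex e e
  refine ⟨e i₀, (fun (A : ι' → ι' → ℝ) i j => A (e i) (e j)) ⁻¹' S, C, hp.measurable hSm,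
    fun t ht A hA => hSt t ht _ hA, fun A hA => ?_, ?_, fun A hA => ?_⟩
  · obtain ⟨γ, hγ⟩ := hS (fun i j => A (e i) (e j)) (by
      rwa [← abs_ne_zero, abs_det_permute, abs_ne_zero])
    refine ⟨⟨reindex e e γ.1, by rw [det_reindex_self, γ.2]⟩, ?_⟩
    change (fun i j => _) ∈ S
    convert! hγ using 1
    ext i j
    simp [intMul, ← Equiv.sum_comp e]
  · have hm : MeasurableSet {A : ι → ι → ℝ | A ∈ S ∧ |(of A).det| ∈ Set.Ioc 0 1} :=
      hSm.inter (measurable_det_of.abs measurableSet_Ioc)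
    rw [← hp.measure_preimage hm.nullMeasurableSet] at hSv
    convert hSv using 2
    ext A
    simp only [Set.mem_ofPred_eq, Set.mem_preimage]
    rw [abs_det_permute]
  · have h1 := hSC _ hA
    rw [abs_det_permute, Fintype.card_congr e] at h1
    refine le_trans (le_of_eq ?_) h1
    congr 1
    refine le_antisymm ?_ ?_ <;> refine (pi_norm_le_iff_of_nonneg (norm_nonneg _)).2 fun j => ?_
    · have := norm_le_pi_norm (fun j => A (e i₀) (e j)) (e.symm j)
      rwa [Equiv.apply_symm_apply] at this
    · exact norm_le_pi_norm (A (e i₀)) (e j)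

variable {κ : Type*}

/-- Vectors whose first coordinate is nonzero and of largest absolute value. -/
def leadingSet (κ : Type*) : Set (Unit ⊕ κ → ℝ) :=
  {b | b (.inl ()) ≠ 0 ∧ ∀ i, |b i| ≤ |b (.inl ())|}

theorem quotTuple_smul {t : ℝ} (ht : t ≠ 0) (A : Unit ⊕ κ → Unit ⊕ κ → ℝ) :
    quotTuple (t • A) = t • quotTuple A := by
  ext i j
  simp only [quotTuple, Pi.smul_apply, smul_eq_mul]
  by_cases h : A (.inl ()) (.inl ()) = 0
  · simp [h]
  · field_simp

theorem smul_mem_blockSet {t : ℝ} (ht : 0 < t) {S : Set (Unit ⊕ κ → ℝ)} {Q : Set (κ → κ → ℝ)}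
    (hS : ∀ b ∈ S, t • b ∈ S) (hQ : ∀ A ∈ Q, t • A ∈ Q) {A : Unit ⊕ κ → Unit ⊕ κ → ℝ}
    (hA : A ∈ blockSet S Q) : t • A ∈ blockSet S Q := by
  refine ⟨hS _ hA.1, fun i => ?_, ?_⟩
  · have := hA.2.1 i
    simp only [Pi.smul_apply, smul_eq_mul, abs_mul, abs_of_pos ht]
    nlinarith
  · rw [quotTuple_smul ht.ne']
    exact hQ _ hA.2.2

theorem smul_mem_leadingSet {t : ℝ} (ht : 0 < t) {b : Unit ⊕ κ → ℝ} (hb : b ∈ leadingSet κ) :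
    t • b ∈ leadingSet κ := by
  refine ⟨mul_ne_zero ht.ne' hb.1, fun i => ?_⟩
  simp only [Pi.smul_apply, smul_eq_mul, abs_mul, abs_of_pos ht]
  exact mul_le_mul_of_nonneg_left (hb.2 i) ht.le

variable [Fintype κ]

theorem measurableSet_leadingSet : MeasurableSet (leadingSet κ) := by
  have h1 : MeasurableSet {b : Unit ⊕ κ → ℝ | b (.inl ()) = 0} :=
    measurableSet_eq_fun (by fun_prop) (by fun_prop)
  have h2 : MeasurableSet {b : Unit ⊕ κ → ℝ | ∀ i, |b i| ≤ |b (.inl ())|} := by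
    rw [Set.ofPred_forall]
    exact MeasurableSet.iInter fun i => measurableSet_le (by fun_prop) (by fun_prop)
  exact h1.compl.inter h2

variable [DecidableEq κ]

/-- Up to sign, any row can be moved to the first position by a unimodular integer matrix. -/
theorem exists_sl_row (i : κ) : ∃ W : SpecialLinearGroup (Unit ⊕ κ) ℤ,
    ∀ A, ‖intMul W.1 A (.inl ())‖ = ‖A (.inr i)‖ := by
  refine ⟨⟨diagonal (Function.update 1 (.inl ()) (-1)) *
    (Equiv.swap (Sum.inl ()) (Sum.inr i)).permMatrix ℤ, ?_⟩, fun A => ?_⟩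
  · rw [det_mul, det_permutation, det_diagonal, Finset.prod_update_of_mem (Finset.mem_univ _),
      Equiv.Perm.sign_swap (by simp)]
    simp
  · rw [← norm_neg (A _)]
    congr 1
    ext j
    simp [intMul, Equiv.Perm.permMatrix, PEquiv.toMatrix_apply, Equiv.toPEquiv_apply]

/-- Every tuple can be moved, up to a permutation of the coordinates, to one whose first vector is
short with leading first coordinate, and which is reduced modulo its first vector. -/
theorem exists_reduced_tuple {i₀ : κ} {S : Set (κ → κ → ℝ)} {C : ℝ}
    (hS : ∀ A : κ → κ → ℝ, (of A).det ≠ 0 → ∃ γ : SpecialLinearGroup κ ℤ, intMul γ.1 A ∈ S)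
    (hC : ∀ A ∈ S, ‖A i₀‖ ^ Fintype.card κ ≤ C * |(of A).det|)
    {A : Unit ⊕ κ → Unit ⊕ κ → ℝ} (hA : (of A).det ≠ 0) :
    ∃ (σ : Equiv.Perm (Unit ⊕ κ)) (γ : SpecialLinearGroup (Unit ⊕ κ) ℤ),
      σ ∈ Set.range (Equiv.swap (.inl ())) ∧
      (fun i j => intMul γ.1 A i (σ j)) ∈ blockSet (leadingSet κ) S ∧
      |intMul γ.1 A (.inl ()) (σ (.inl ()))| ^ (Fintype.card κ + 1) ≤
        6 ^ Fintype.card κ * C * |(of A).det| := by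
  obtain ⟨c, hc, hcle⟩ := exists_le_norm_intMul hA
  let f : SpecialLinearGroup (Unit ⊕ κ) ℤ → ℝ := fun γ => ‖intMul γ.1 A (.inl ())‖
  have hbdd : BddBelow (Set.range f) := ⟨c, by rintro _ ⟨γ, rfl⟩; exact hcle γ _⟩
  have hm : c ≤ iInf f := le_ciInf fun γ => hcle γ _
  obtain ⟨γ₀, hγ₀⟩ := exists_lt_of_ciInf_lt (f := f) (a := 3 / 2 * iInf f) (by linarith)
  have hmin : ∀ γ : SpecialLinearGroup (Unit ⊕ κ) ℤ,
      ‖intMul γ₀.1 A (.inl ())‖ ≤ 3 / 2 * ‖intMul γ.1 A (.inl ())‖ := fun γ =>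
    hγ₀.le.trans (by have : iInf f ≤ f γ := ciInf_le hbdd γ; change _ ≤ 3 / 2 * f γ; linarith)
  obtain ⟨j₀, hj₀⟩ := Finite.exists_max fun j => |intMul γ₀.1 A (.inl ()) j|
  set σ := Equiv.swap (Sum.inl ()) j₀ with hσ
  have hσj : σ (.inl ()) = j₀ := Equiv.swap_apply_left _ _
  set A₂ : Unit ⊕ κ → Unit ⊕ κ → ℝ := fun i j => intMul γ₀.1 A i (σ j) with hA₂
  have hnorm : ‖intMul γ₀.1 A (.inl ())‖ = |A₂ (.inl ()) (.inl ())| := by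
    rw [hA₂]
    simp only [hσj]
    exact le_antisymm ((pi_norm_le_iff_of_nonneg (abs_nonneg _)).2 hj₀)
      (norm_le_pi_norm (intMul γ₀.1 A (.inl ())) j₀)
  have hdet₂ : |(of A₂).det| = |(of A).det| := by
    rw [← det_intMul γ₀ A]
    exact abs_det_permute (Equiv.refl _) σ (intMul γ₀.1 A)
  have ha : 0 < |A₂ (.inl ()) (.inl ())| := by rw [← hnorm]; exact hc.trans_le (hcle _ _)
  obtain ⟨s, γ', hr, hq⟩ := exists_lowerSL hS (A := A₂)
    (by rwa [← abs_ne_zero, hdet₂, abs_ne_zero]) (abs_pos.1 ha)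
  have hA₃ : (fun i j => intMul (lowerSL s γ' * γ₀).1 A i (σ j)) = intMul (lowerSL s γ').1 A₂ := by
    rw [intMul_coe_mul]
    rfl
  have hA₃' : intMul (lowerSL s γ' * γ₀).1 A (.inl ()) (σ (.inl ())) =
      intMul (lowerSL s γ').1 A₂ (.inl ()) (.inl ()) := by rw [← hA₃]
  refine ⟨σ, lowerSL s γ' * γ₀, ⟨_, rfl⟩, ?_, ?_⟩
  · rw [hA₃]
    refine ⟨?_, ?_, hq⟩
    · rw [intMul_lowerSL_inl]
      refine ⟨abs_pos.1 ha, fun i => ?_⟩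
      rw [← hnorm]
      exact norm_le_pi_norm (intMul γ₀.1 A (.inl ())) (σ i)
    · rwa [intMul_lowerSL_inl]
  · rw [hA₃', intMul_lowerSL_inl]
    set a := A₂ (.inl ()) (.inl ()) with ha'
    set A₃ := intMul (lowerSL s γ').1 A₂ with hA₃def
    set q := ‖quotTuple A₃ i₀‖ with hqdef
    obtain ⟨W, hW⟩ := exists_sl_row i₀
    have h1 : |a| ≤ 3 / 2 * ‖A₃ (.inr i₀)‖ := by
      rw [← hnorm]
      refine (hmin (W * (lowerSL s γ' * γ₀))).trans ?_
      rw [intMul_coe_mul, hW, ← hA₃]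
      gcongr
      refine (pi_norm_le_iff_of_nonneg (norm_nonneg _)).2 fun j => ?_
      have := norm_le_pi_norm
        (fun j => intMul (lowerSL s γ' * γ₀).1 A (.inr i₀) (σ j)) (σ.symm j)
      rwa [Equiv.apply_symm_apply] at this
    have hlead : ∀ j, |A₂ (.inl ()) j| ≤ |a| := fun j => by
      rw [← hnorm]
      exact norm_le_pi_norm (intMul γ₀.1 A (.inl ())) (σ j)
    have h2 : ‖A₃ (.inr i₀)‖ ≤ q + |a| / 2 := by
      refine (pi_norm_le_iff_of_nonneg (by positivity)).2 fun j => ?_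
      rw [Real.norm_eq_abs]
      rcases j with ⟨⟩ | j
      · exact (hr i₀).trans (by have := norm_nonneg (quotTuple A₃ i₀); linarith)
      · have e : A₃ (.inr i₀) (.inr j) =
            quotTuple A₃ i₀ j + A₃ (.inr i₀) (.inl ()) * A₂ (.inl ()) (.inr j) / a := by
          simp only [quotTuple, hA₃def, intMul_lowerSL_inl, ha']
          ring
        rw [e]
        refine (abs_add_le _ _).trans (add_le_add (norm_le_pi_norm (quotTuple A₃ i₀) j) ?_)
        rw [abs_div, abs_mul, div_le_iff₀ ha]
        exact mul_le_mul (hr i₀) (hlead _) (abs_nonneg _) (by positivity)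
    have h3 : |a| ≤ 6 * q := by linarith
    have h4 : |(of A).det| = |a| * |(of (quotTuple A₃)).det| := by
      rw [← hdet₂, ← det_intMul (lowerSL s γ') A₂, ← hA₃def, det_eq_mul_det_quotTuple, abs_mul,
        hA₃def, intMul_lowerSL_inl]
      rw [hA₃def, intMul_lowerSL_inl]
      exact abs_pos.1 ha
    rw [h4, pow_succ]
    calc |a| ^ Fintype.card κ * |a| ≤ (6 * q) ^ Fintype.card κ * |a| := by gcongr
      _ = 6 ^ Fintype.card κ * q ^ Fintype.card κ * |a| := by rw [mul_pow]
      _ ≤ 6 ^ Fintype.card κ * (C * |(of (quotTuple A₃)).det|) * |a| := by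
          gcongr
          exact hC _ hq
      _ = _ := by ring

theorem HasReduction.unit_sum [Nonempty κ] (h : HasReduction κ) : HasReduction (Unit ⊕ κ) := by
  obtain ⟨i₀, S, C, hSm, hSt, hS, hSv, hSC⟩ := h
  set k := Fintype.card κ with hk
  set B : Set (Unit ⊕ κ → Unit ⊕ κ → ℝ) := {A | A ∈ blockSet (leadingSet κ) S ∧
    |A (.inl ()) (.inl ())| ^ (k + 1) ≤ 6 ^ k * C * |(of A).det|} with hB
  have hBm : MeasurableSet B := by
    refine (measurableSet_blockSet measurableSet_leadingSet hSm).inter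
      (measurableSet_le ?_ (measurable_det_of.abs.const_mul _))
    fun_prop
  let sw : Unit ⊕ κ → (Unit ⊕ κ → Unit ⊕ κ → ℝ) → Unit ⊕ κ → Unit ⊕ κ → ℝ :=
    fun l A i j => A i (Equiv.swap (.inl ()) l j)
  have hsw : ∀ l, MeasurePreserving (sw l) volume volume := fun l =>
    measurePreserving_reindex (Equiv.refl _) _
  have hswd : ∀ l A, |(of (sw l A)).det| = |(of A).det| := fun l A =>
    abs_det_permute (Equiv.refl _) (Equiv.swap (Sum.inl ()) l) A
  have hcard : Fintype.card (Unit ⊕ κ) = k + 1 := by simp [hk, add_comm]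
  refine ⟨.inl (), ⋃ l, sw l ⁻¹' B, 6 ^ k * C, MeasurableSet.iUnion fun l =>
    (hsw l).measurable hBm, fun t ht A hA => ?_, fun A hA => ?_, ?_, fun A hA => ?_⟩
  · obtain ⟨l, hl⟩ := Set.mem_iUnion.1 hA
    refine Set.mem_iUnion.2 ⟨l, ?_⟩
    change t • sw l A ∈ B
    refine ⟨smul_mem_blockSet ht (fun b hb => smul_mem_leadingSet ht hb) (hSt t ht) hl.1, ?_⟩
    have h1 : (of (t • sw l A)).det = t ^ (k + 1) * (of (sw l A)).det := by
      rw [← hcard, ← det_smul]; rfl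
    have h2 := hl.2
    rw [h1, abs_mul, abs_of_pos (pow_pos ht _)]
    simp only [Pi.smul_apply, smul_eq_mul, abs_mul, abs_of_pos ht, mul_pow]
    calc _ ≤ t ^ (k + 1) * (6 ^ k * C * |(of (sw l A)).det|) := by gcongr
      _ = _ := by ring
  · obtain ⟨σ, γ, ⟨l, rfl⟩, h1, h2⟩ := exists_reduced_tuple hS hSC hA
    refine ⟨γ, Set.mem_iUnion.2 ⟨l, h1, ?_⟩⟩
    rw [hswd, det_intMul]
    exact h2
  · have h0 : {A : Unit ⊕ κ → Unit ⊕ κ → ℝ |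
        A ∈ ⋃ l, sw l ⁻¹' B ∧ |(of A).det| ∈ Set.Ioc 0 1} ⊆
        ⋃ l, sw l ⁻¹' (B ∩ {A | |(of A).det| ∈ Set.Ioc 0 1}) := by
      rintro A ⟨hA, hA'⟩
      obtain ⟨l, hl⟩ := Set.mem_iUnion.1 hA
      refine Set.mem_iUnion.2 ⟨l, hl, ?_⟩
      change |(of (sw l A)).det| ∈ Set.Ioc 0 1
      rwa [hswd]
    refine (measure_mono h0).trans_lt ((measure_iUnion_fintype_le _ _).trans_lt ?_)
    refine ENNReal.sum_lt_top.2 fun l _ => ?_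
    have hm1 : MeasurableSet {A : Unit ⊕ κ → Unit ⊕ κ → ℝ | |(of A).det| ∈ Set.Ioc 0 1} :=
      measurable_det_of.abs measurableSet_Ioc
    rw [(hsw l).measure_preimage (hBm.inter hm1).nullMeasurableSet]
    set S₀ : Set (Unit ⊕ κ → ℝ) :=
      leadingSet κ ∩ {b | |b (.inl ())| ^ (k + 1) ≤ |6 ^ k * C|} with hS₀
    have hS₀m : MeasurableSet S₀ :=
      measurableSet_leadingSet.inter (measurableSet_le (by fun_prop) (by fun_prop))
    have hsub : B ∩ {A : Unit ⊕ κ → Unit ⊕ κ → ℝ | |(of A).det| ∈ Set.Ioc 0 1} ⊆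
        {A | A ∈ blockSet S₀ S ∧ |(of A).det| ∈ Set.Ioc 0 1} := by
      rintro A ⟨⟨⟨h1, h2, h3⟩, h4⟩, h5⟩
      refine ⟨⟨⟨h1, h4.trans ?_⟩, h2, h3⟩, h5⟩
      calc _ ≤ |6 ^ k * C| * |(of A).det| := by gcongr; exact le_abs_self _
        _ ≤ |6 ^ k * C| * 1 := by gcongr; exact h5.2
        _ = _ := mul_one _
    refine (measure_mono hsub).trans_lt ?_
    rw [volume_blockSet hS₀m (fun b hb => hb.1.1) hSm hSt measurableSet_Ioc]
    refine ENNReal.mul_lt_top ?_ hSv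
    refine (measure_mono (t := Metric.closedBall 0 (max 1 |6 ^ k * C|)) fun b hb => ?_).trans_lt
      (isCompact_closedBall _ _).measure_lt_top
    rw [mem_closedBall_zero_iff, pi_norm_le_iff_of_nonneg (by positivity)]
    intro i
    refine (hb.1.2 i).trans ?_
    rcases le_total |b (.inl ())| 1 with h | h
    · exact h.trans (le_max_left _ _)
    · exact (le_self_pow₀ h (by lia)).trans (hb.2.trans (le_max_right _ _))
  · obtain ⟨l, hl⟩ := Set.mem_iUnion.1 hA
    have h2 := hl.2
    rw [hswd] at h2
    rw [hcard]
    refine le_trans (pow_le_pow_left₀ (norm_nonneg _) ?_ _) h2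
    refine (pi_norm_le_iff_of_nonneg (abs_nonneg _)).2 fun j => ?_
    have := hl.1.1.2 (Equiv.swap (.inl ()) l j)
    simpa [sw] using this

theorem hasReduction_of_nonempty (κ : Type*) [Fintype κ] [DecidableEq κ] [Nonempty κ] :
    HasReduction κ := by
  have h : ∀ n, HasReduction (Fin (n + 1)) := by
    intro n
    induction n with
    | zero => exact hasReduction_fin_one
    | succ n ih => exact ih.unit_sum.equiv (Fintype.equivOfCardEq (by simp [add_comm]))
  obtain ⟨n, hn⟩ := Nat.exists_eq_add_of_lt (Fintype.card_pos (α := κ))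
  exact (h n).equiv (Fintype.equivOfCardEq (by simp [hn]))

end Reduction

section IntegralSubgroups

open scoped ENNReal NNReal

variable {ι : Type*} [Fintype ι] [DecidableEq ι]

/-- The inclusion `SL(ι, ℤ) → SL(ι, ℝ)`. -/
abbrev intSL (ι : Type*) [Fintype ι] [DecidableEq ι] :
    SpecialLinearGroup ι ℤ →* SpecialLinearGroup ι ℝ :=
  SpecialLinearGroup.map (Int.castRingHom ℝ)

theorem intSL_apply (γ : SpecialLinearGroup ι ℤ) (i j : ι) :
    (intSL ι γ).1 i j = (γ.1 i j : ℝ) := rfl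

theorem finite_bounded_intSL (R : ℝ) :
    {g | g ∈ (intSL ι).range ∧ ∀ i j, |g.1 i j| ≤ R}.Finite := by
  have h1 : {A : ι → ι → ℤ | ∀ i j, A i j ∈ Set.Icc (-⌊R⌋) ⌊R⌋}.Finite := by
    have := Set.Finite.pi' fun _ : ι => Set.Finite.pi' fun _ : ι => Set.finite_Icc (-⌊R⌋) ⌊R⌋
    exact this
  have h2 : {γ : SpecialLinearGroup ι ℤ | ∀ i j, γ.1 i j ∈ Set.Icc (-⌊R⌋) ⌊R⌋}.Finite :=
    h1.preimage (f := fun γ : SpecialLinearGroup ι ℤ => γ.1) Subtype.val_injective.injOn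
  refine (h2.image (intSL ι)).subset ?_
  rintro _ ⟨⟨γ, rfl⟩, h⟩
  refine ⟨γ, fun i j => ?_, rfl⟩
  have := h i j
  rw [intSL_apply, ← Int.cast_abs, ← Int.le_floor] at this
  exact abs_le.1 this

theorem exists_bound_of_isCompact_sl {K : Set (SpecialLinearGroup ι ℝ)} (hK : IsCompact K) :
    ∃ R, ∀ g ∈ K, ∀ i j, |g.1 i j| ≤ R := by
  have h : ∀ p : ι × ι, ∃ R, ∀ g ∈ K, |g.1 p.1 p.2| ≤ R := fun p =>
    hK.exists_bound_of_continuousOn (continuous_sl_apply p.1 p.2).continuousOn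
  choose R hR using h
  refine ⟨∑ p, |R p|, fun g hg i j => (hR (i, j) g hg).trans ((le_abs_self _).trans ?_)⟩
  exact Finset.single_le_sum (f := fun p => |R p|) (fun _ _ => abs_nonneg _) (Finset.mem_univ _)

/-- The lift to `G` of an invariant probability measure on `G ⧸ Γ` is a multiple of Haar measure. -/
theorem exists_liftMeasure_eq [Nonempty ι] {Γ : Subgroup (SpecialLinearGroup ι ℝ)} [Countable Γ]
    (hΓ : Γ ≤ (intSL ι).range) (μ : Measure (SpecialLinearGroup ι ℝ ⧸ Γ)) [IsProbabilityMeasure μ]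
    (hμ : ∀ g : SpecialLinearGroup ι ℝ, Measure.map (fun x => g • x) μ = μ) :
    ∃ c : ℝ≥0, c ≠ 0 ∧ liftMeasure Γ μ = c • coneMeasure ι := by
  have := isMulLeftInvariant_liftMeasure Γ μ hμ
  have := coneMeasure_isHaar (ι := ι)
  have : IsFiniteMeasureOnCompacts (liftMeasure Γ μ) := by
    refine ⟨fun K hK => ?_⟩
    obtain ⟨R, hR⟩ := exists_bound_of_isCompact_sl (hK.inv.mul hK)
    refine (liftMeasure_le Γ μ (E := Set.univ) hK.measurableSet (fun _ _ => trivial)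
      (finite_bounded_intSL R) fun g hg γ hγ hgγ => ⟨hΓ hγ, hR γ ?_⟩).trans_lt ?_
    · exact ⟨g⁻¹, Set.inv_mem_inv.2 hg, g * γ, hgγ, by group⟩
    · exact ENNReal.mul_lt_top (ENNReal.natCast_lt_top _) (measure_lt_top _ _)
  have heq := Measure.isMulLeftInvariant_eq_smul (liftMeasure Γ μ) (coneMeasure ι)
  refine ⟨_, fun h0 => ?_, heq⟩
  rw [h0, zero_smul] at heq
  have := measure_le_liftMeasure Γ μ (E := Set.univ) MeasurableSet.univ
    fun x _ => (QuotientGroup.mk_surjective x).imp fun g hg => ⟨trivial, hg⟩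
  rw [heq, measure_univ] at this
  simp at this

variable {ι' : Type*}

/-- The tuple of the columns of `g`, with indices renamed. -/
def colTuple (e : ι' ≃ ι) (g : SpecialLinearGroup ι ℝ) : ι' → ι' → ℝ := fun i j => g.1 (e j) (e i)

theorem measurable_colTuple (e : ι' ≃ ι) : Measurable (colTuple e) :=
  measurable_pi_lambda _ fun _ => measurable_pi_lambda _ fun _ =>
    (continuous_sl_apply _ _).measurable

variable [Fintype ι'] [DecidableEq ι']

theorem det_colTuple (e : ι' ≃ ι) (g : SpecialLinearGroup ι ℝ) : (of (colTuple e g)).det = 1 := by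
  have : of (colTuple e g) = (g.1.submatrix e e)ᵀ := rfl
  rw [this, det_transpose, det_submatrix_equiv_self, g.2]

/-- The integer matrix through which `γ` acts on column tuples. -/
def slReindex (e : ι' ≃ ι) (γ : SpecialLinearGroup ι ℤ) : SpecialLinearGroup ι' ℤ :=
  ⟨(γ.1.submatrix e e)ᵀ, by rw [det_transpose, det_submatrix_equiv_self, γ.2]⟩

theorem slReindex_apply (e : ι' ≃ ι) (γ : SpecialLinearGroup ι ℤ) (i j : ι') :
    (slReindex e γ).1 i j = γ.1 (e j) (e i) := rfl

theorem slReindex_surjective (e : ι' ≃ ι) : Function.Surjective (slReindex e) := fun δ =>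
  ⟨slReindex e.symm δ, by ext i j; simp [slReindex_apply]⟩

theorem colTuple_mul_intSL (e : ι' ≃ ι) (g : SpecialLinearGroup ι ℝ) (γ : SpecialLinearGroup ι ℤ) :
    colTuple e (g * intSL ι γ) = intMul (slReindex e γ).1 (colTuple e g) := by
  ext i j
  have h : (g * intSL ι γ).1 (e j) (e i) = ∑ k, g.1 (e j) k * (intSL ι γ).1 k (e i) := rfl
  simp only [colTuple, intMul, slReindex_apply]
  rw [h, ← e.sum_comp]
  simp [intSL_apply, mul_comm]

theorem coneMeasure_preimage_colTuple [Nonempty ι] (e : ι' ≃ ι) {P : Set (ι' → ι' → ℝ)}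
    (hP : MeasurableSet P) : coneMeasure ι (colTuple e ⁻¹' P) = volume {A : ι' → ι' → ℝ |
      (of A).det ^ (-(Fintype.card ι : ℝ)⁻¹) • A ∈ P ∧ (of A).det ∈ Set.Ioc 0 1} := by
  have hp := measurePreserving_reindex e e
  have hm : MeasurableSet {A : ι' → ι' → ℝ |
      (of A).det ^ (-(Fintype.card ι : ℝ)⁻¹) • A ∈ P ∧ (of A).det ∈ Set.Ioc 0 1} := by
    refine MeasurableSet.inter ?_ (measurableSet_det_mem measurableSet_Ioc)
    exact ((measurable_det_of.pow_const _).smul measurable_id) hP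
  rw [coneMeasure_apply (measurable_colTuple e hP), ← hp.measure_preimage hm.nullMeasurableSet]
  congr 1
  ext A
  have hdet : (of fun i j => A (e i) (e j)).det = (of A).det :=
    det_submatrix_equiv_self e (of A)
  simp only [Set.mem_ofPred_eq, Set.mem_preimage]
  rw [hdet]
  refine and_congr_left fun hA => ?_
  have : colTuple e (normalizeSL A) =
      (of A).det ^ (-(Fintype.card ι : ℝ)⁻¹) • fun i j => A (e i) (e j) := by
    ext i j
    rw [colTuple, normalizeSL_apply hA.1]
    rfl
  rw [this]

/-- The orbit of a vector under a group of integral matrices stays away from zero. -/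
theorem exists_le_norm_col (g : SpecialLinearGroup ι ℝ) (i₀ : ι) :
    ∃ c : ℝ, 0 < c ∧ ∀ γ ∈ (intSL ι).range, c ≤ ‖(g * γ).1.col i₀‖ := by
  obtain ⟨c, hc, h⟩ := exists_le_norm_intMul (A := colTuple (Equiv.refl ι) g)
    (by rw [det_colTuple]; exact one_ne_zero)
  refine ⟨c, hc, ?_⟩
  rintro _ ⟨γ, rfl⟩
  have := h (slReindex (Equiv.refl ι) γ) i₀
  rwa [← colTuple_mul_intSL] at this

end IntegralSubgroups

section UpperBound

open scoped ENNReal NNReal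

variable {ι κ : Type*} [Fintype ι] [Fintype κ]

theorem rpow_neg_inv_pow {x : ℝ} (hx : 0 < x) {n : ℕ} (hn : n ≠ 0) :
    (x ^ (-(n : ℝ)⁻¹)) ^ n * x = 1 := by
  rw [← Real.rpow_natCast, ← Real.rpow_mul hx.le, neg_mul, inv_mul_cancel₀ (by exact_mod_cast hn),
    Real.rpow_neg_one, inv_mul_cancel₀ hx.ne']

theorem volume_coord_eq_zero (i j : ι) : volume {A : ι → ι → ℝ | A i j = 0} = 0 := by
  let L : (ι → ι → ℝ) →ₗ[ℝ] ℝ := LinearMap.proj j ∘ₗ LinearMap.proj i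
  have := Measure.addHaar_submodule (volume : Measure (ι → ι → ℝ)) (LinearMap.ker L) fun h => by
    have h1 : (fun _ _ => 1 : ι → ι → ℝ) ∈ LinearMap.ker L := h ▸ Submodule.mem_top
    exact one_ne_zero (α := ℝ) h1
  exact this

theorem card_of_equiv_unit_sum (e : Unit ⊕ κ ≃ ι) : Fintype.card ι = Fintype.card κ + 1 := by
  rw [← Fintype.card_congr e]
  simp [add_comm]

/-- Tuples with first vector of norm at most `ε` which are reduced modulo their first vector, or
whose first coordinate vanishes. -/
def shortTuples (ε : ℝ) (S : Set (κ → κ → ℝ)) : Set (Unit ⊕ κ → Unit ⊕ κ → ℝ) :=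
  {A | A (.inl ()) (.inl ()) = 0} ∪ blockSet {b | b (.inl ()) ≠ 0 ∧ ∀ i, |b i| ≤ ε} S

theorem measurableSet_short (ε : ℝ) :
    MeasurableSet {b : Unit ⊕ κ → ℝ | b (.inl ()) ≠ 0 ∧ ∀ i, |b i| ≤ ε} := by
  have h1 : MeasurableSet {b : Unit ⊕ κ → ℝ | b (.inl ()) = 0} :=
    measurableSet_eq_fun (by fun_prop) (by fun_prop)
  have h2 : MeasurableSet {b : Unit ⊕ κ → ℝ | ∀ i, |b i| ≤ ε} := by
    rw [Set.ofPred_forall]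
    exact MeasurableSet.iInter fun i => measurableSet_le (by fun_prop) (by fun_prop)
  exact h1.compl.inter h2

theorem measurableSet_shortTuples (ε : ℝ) {S : Set (κ → κ → ℝ)} (hS : MeasurableSet S) :
    MeasurableSet (shortTuples ε S) := by
  have h : MeasurableSet {A : Unit ⊕ κ → Unit ⊕ κ → ℝ | A (.inl ()) (.inl ()) = 0} :=
    measurableSet_eq_fun (by fun_prop) (by fun_prop)
  exact h.union (measurableSet_blockSet (measurableSet_short ε) hS)

variable [DecidableEq ι] [DecidableEq κ]

theorem coneMeasure_short_le [Nonempty κ] [Nonempty ι] (e : Unit ⊕ κ ≃ ι) {S : Set (κ → κ → ℝ)}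
    (hSm : MeasurableSet S) (hSt : ∀ t : ℝ, 0 < t → ∀ A ∈ S, t • A ∈ S) {ε : ℝ} (hε : 0 < ε) :
    coneMeasure ι (colTuple e ⁻¹' shortTuples ε S) ≤
      2 ^ Fintype.card ι * volume {A : κ → κ → ℝ | A ∈ S ∧ |(of A).det| ∈ Set.Ioc 0 1} *
        ENNReal.ofReal (ε ^ Fintype.card ι) := by
  set Sε : Set (Unit ⊕ κ → ℝ) := {b | b (.inl ()) ≠ 0 ∧ ∀ i, |b i| ≤ ε} with hSε
  have hSεm : MeasurableSet Sε := measurableSet_short ε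
  have hSεv : volume Sε ≤ 2 ^ Fintype.card ι * ENNReal.ofReal (ε ^ Fintype.card ι) := by
    refine (measure_mono (t := Metric.closedBall 0 ε) fun b hb => ?_).trans_eq ?_
    · rw [mem_closedBall_zero_iff, pi_norm_le_iff_of_nonneg hε.le]
      exact hb.2
    · rw [Real.volume_pi_closedBall _ hε.le, Fintype.card_congr e, mul_pow,
        ENNReal.ofReal_mul (by positivity), ENNReal.ofReal_pow zero_le_two, ENNReal.ofReal_ofNat]
  rw [coneMeasure_preimage_colTuple e (measurableSet_shortTuples ε hSm)]
  refine (measure_mono (t := {A | A (.inl ()) (.inl ()) = 0} ∪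
    {A | A ∈ blockSet Sε S ∧ |(of A).det| ∈ Set.Ioc 0 1}) ?_).trans ?_
  · rintro A ⟨hA, hd⟩
    set t := (of A).det ^ (-(Fintype.card ι : ℝ)⁻¹) with ht
    have htp : 0 < t := Real.rpow_pos_of_pos hd.1 _
    have ht1 : 1 ≤ t := Real.one_le_rpow_of_pos_of_le_one_of_nonpos hd.1 hd.2
      (by simp)
    rcases hA with hA | hA
    · exact Or.inl ((mul_eq_zero.1 hA).resolve_left htp.ne')
    · right
      refine ⟨?_, by rwa [abs_of_pos hd.1]⟩
      have h := smul_mem_blockSet (inv_pos.2 htp) (S := Sε) (fun b hb => ⟨?_, fun i => ?_⟩)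
        (hSt _ (inv_pos.2 htp)) hA
      · rwa [smul_smul, inv_mul_cancel₀ htp.ne', one_smul] at h
      · exact mul_ne_zero (inv_pos.2 htp).ne' hb.1
      · simp only [Pi.smul_apply, smul_eq_mul, abs_mul, abs_of_pos (inv_pos.2 htp)]
        exact (mul_le_of_le_one_left (abs_nonneg _) (inv_le_one_of_one_le₀ ht1)).trans (hb.2 i)
  · refine (measure_union_le _ _).trans ?_
    rw [volume_coord_eq_zero, zero_add,
      volume_blockSet hSεm (fun b hb => hb.1) hSm hSt measurableSet_Ioc, mul_right_comm]
    gcongr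

theorem exists_measure_short_le [Nonempty κ] [Nonempty ι] (e : Unit ⊕ κ ≃ ι)
    {Γ : Subgroup (SpecialLinearGroup ι ℝ)} [Countable Γ] (hΓ : Γ ≤ (intSL ι).range)
    (hΓ' : ∀ γ : SpecialLinearGroup ι ℤ, γ.1.col (e (.inl ())) = Pi.single (e (.inl ())) 1 →
      intSL ι γ ∈ Γ)
    (μ : Measure (SpecialLinearGroup ι ℝ ⧸ Γ)) [IsProbabilityMeasure μ]
    (hμ : ∀ g : SpecialLinearGroup ι ℝ, Measure.map (fun x => g • x) μ = μ) :
    ∃ C : ℝ≥0∞, C ≠ ∞ ∧ ∀ ε : ℝ, 0 < ε → ∀ E : Set (SpecialLinearGroup ι ℝ ⧸ Γ),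
      (∀ x ∈ E, ∃ g : SpecialLinearGroup ι ℝ, (g : SpecialLinearGroup ι ℝ ⧸ Γ) = x ∧
        ‖g.1.col (e (.inl ()))‖ ≤ ε) →
      μ E ≤ C * ENNReal.ofReal (ε ^ Fintype.card ι) := by
  obtain ⟨c, -, hc⟩ := exists_liftMeasure_eq hΓ μ hμ
  obtain ⟨i₀, S, -, hSm, hSt, hS, hSv, -⟩ := hasReduction_of_nonempty κ
  refine ⟨c * (2 ^ Fintype.card ι * volume {A : κ → κ → ℝ | A ∈ S ∧ |(of A).det| ∈ Set.Ioc 0 1}),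
    by finiteness, fun ε hε E hE => ?_⟩
  rw [mul_assoc]
  refine (measure_le_liftMeasure Γ μ (measurable_colTuple e (measurableSet_shortTuples ε hSm))
    fun x hx => ?_).trans ?_
  swap
  · rw [hc, Measure.smul_apply, ENNReal.smul_def, smul_eq_mul]
    gcongr
    exact coneMeasure_short_le e hSm hSt hε
  obtain ⟨g, rfl, hg⟩ := hE x hx
  have hg' : ∀ i, |colTuple e g (.inl ()) i| ≤ ε := fun i =>
    (norm_le_pi_norm (g.1.col (e (.inl ()))) (e i)).trans hg
  by_cases ha : colTuple e g (.inl ()) (.inl ()) = 0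
  · exact ⟨g, Or.inl ha, rfl⟩
  obtain ⟨s, γ, h1, h2⟩ := exists_lowerSL hS (A := colTuple e g)
    (by rw [det_colTuple]; exact one_ne_zero) ha
  obtain ⟨δ, hδ⟩ := slReindex_surjective e (lowerSL s γ)
  refine ⟨g * intSL ι δ, Or.inr ?_, QuotientGroup.mk_mul_of_mem g (hΓ' δ ?_)⟩
  · rw [colTuple_mul_intSL, hδ]
    refine ⟨?_, ?_, h2⟩
    · rw [intMul_lowerSL_inl]
      exact ⟨ha, hg'⟩
    · rwa [intMul_lowerSL_inl]
  · ext i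
    obtain ⟨j, rfl⟩ := e.surjective i
    rw [col_apply, ← slReindex_apply, hδ]
    rcases j with ⟨⟩ | j <;> simp [lowerSL]

end UpperBound

section BalancedSet

variable (κ : Type*) [Fintype κ] [DecidableEq κ]

/-- Tuples of positive determinant with entries bounded in terms of the determinant. -/
def balancedSet : Set (κ → κ → ℝ) :=
  {A | 0 < (of A).det ∧ ∀ i j, |A i j| ^ Fintype.card κ ≤ 2 * (of A).det}

theorem measurableSet_balancedSet : MeasurableSet (balancedSet κ) := by
  have h1 : MeasurableSet {A : κ → κ → ℝ | ∀ i j, |A i j| ^ Fintype.card κ ≤ 2 * (of A).det} := by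
    simp_rw [Set.ofPred_forall]
    exact MeasurableSet.iInter fun i => MeasurableSet.iInter fun j =>
      measurableSet_le (by fun_prop) (measurable_det_of.const_mul _)
  exact (measurableSet_det_mem measurableSet_Ioi).inter h1

variable {κ}

theorem smul_mem_balancedSet {t : ℝ} (ht : 0 < t) {A : κ → κ → ℝ} (hA : A ∈ balancedSet κ) :
    t • A ∈ balancedSet κ := by
  have h1 : (of (t • A)).det = t ^ Fintype.card κ * (of A).det := by rw [← det_smul]; rfl
  have h2 := pow_pos ht (Fintype.card κ)
  refine ⟨by rw [h1]; exact mul_pos h2 hA.1, fun i j => ?_⟩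
  have h3 := hA.2 i j
  rw [h1]
  simp only [Pi.smul_apply, smul_eq_mul, abs_mul, abs_of_pos ht, mul_pow]
  nlinarith

theorem volume_balancedSet_pos [Nonempty κ] {a : ℝ} (ha : a < 3 / 4) :
    volume {A : κ → κ → ℝ | A ∈ balancedSet κ ∧ |(of A).det| ∈ Set.Icc a 1} ≠ 0 := by
  set k := Fintype.card κ with hk
  have hk0 : k ≠ 0 := Fintype.card_ne_zero
  have hc : Continuous fun A : κ → κ → ℝ => (of A).det :=
    Continuous.matrix_det (A := fun A : κ → κ → ℝ => of A) continuous_id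
  set U : Set (κ → κ → ℝ) := {A | (of A).det ∈ Set.Ioo (max 0 a) 1} ∩
    ⋂ i, ⋂ j, {A | |A i j| ^ k < 2 * (of A).det} with hU
  have hUo : IsOpen U := by
    refine (isOpen_Ioo.preimage hc).inter (isOpen_iInter_of_finite fun i =>
      isOpen_iInter_of_finite fun j => isOpen_lt (by fun_prop) (hc.const_mul 2))
  have hUn : U.Nonempty := by
    set r : ℝ := (3 / 4 : ℝ) ^ ((k : ℝ)⁻¹) with hr
    have hr0 : 0 ≤ r := by positivity
    have hrk : r ^ k = 3 / 4 := by
      rw [hr, ← Real.rpow_natCast, ← Real.rpow_mul (by norm_num),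
        inv_mul_cancel₀ (by exact_mod_cast hk0), Real.rpow_one]
    refine ⟨diagonal fun _ => r, ?_⟩
    have hd : (of (diagonal fun _ : κ => r)).det = 3 / 4 := by
      change (diagonal fun _ : κ => r).det = _
      simp [← hk, hrk]
    refine ⟨?_, ?_⟩
    · change (of (diagonal fun _ : κ => r)).det ∈ Set.Ioo (max 0 a) 1
      rw [hd]
      exact ⟨max_lt (by norm_num) ha, by norm_num⟩
    · refine Set.mem_iInter.2 fun i => Set.mem_iInter.2 fun j => ?_
      change |(diagonal fun _ : κ => r) i j| ^ k < 2 * (of (diagonal fun _ : κ => r)).det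
      rw [hd]
      rcases eq_or_ne i j with rfl | hij
      · rw [diagonal_apply_eq, abs_of_nonneg hr0, hrk]
        norm_num
      · rw [diagonal_apply_ne _ hij, abs_zero, zero_pow hk0]
        norm_num
  refine ((hUo.measure_pos volume hUn).trans_le (measure_mono ?_)).ne'
  rintro A ⟨hA, hA'⟩
  simp only [Set.mem_iInter] at hA'
  have h0 : 0 < (of A).det := (le_max_left _ _).trans_lt hA.1
  refine ⟨⟨h0, fun i j => (hA' i j).le⟩, ?_⟩
  rw [abs_of_pos h0]
  exact ⟨((le_max_right _ _).trans_lt hA.1).le, hA.2.le⟩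

/-- Balanced tuples of determinant one, and their inverses, have bounded entries. -/
theorem exists_inverse_bound (κ : Type*) [Fintype κ] [DecidableEq κ] [Nonempty κ] :
    ∃ C : ℝ, 0 < C ∧ ∀ A ∈ balancedSet κ,
      (∀ i j, |(of A).det ^ (-(Fintype.card κ : ℝ)⁻¹) * A i j| ≤ 2) ∧
      ∃ Y : Matrix κ κ ℝ, ((of A).det ^ (-(Fintype.card κ : ℝ)⁻¹) • of A) * Y = 1 ∧
        ∀ i j, |Y i j| ≤ C := by
  set k := Fintype.card κ with hk
  have hk0 : k ≠ 0 := Fintype.card_ne_zero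
  let f : (κ → κ → ℝ) → κ → κ → ℝ := fun A => (of A).adjugate
  have hf : Continuous f :=
    Continuous.matrix_adjugate (A := fun A : κ → κ → ℝ => of A) continuous_id
  obtain ⟨C, hC⟩ := (isCompact_closedBall (0 : κ → κ → ℝ) 2).exists_bound_of_continuousOn
    hf.continuousOn
  refine ⟨|C| + 1, by positivity, fun A hA => ?_⟩
  set t := (of A).det ^ (-(k : ℝ)⁻¹) with ht
  have htp : 0 < t := Real.rpow_pos_of_pos hA.1 _
  have htk : t ^ k * (of A).det = 1 := rpow_neg_inv_pow hA.1 hk0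
  have h1 : ∀ i j, |t * A i j| ≤ 2 := fun i j => by
    refine le_of_pow_le_pow_left₀ hk0 zero_le_two ?_
    rw [abs_mul, abs_of_pos htp, mul_pow]
    calc t ^ k * |A i j| ^ k ≤ t ^ k * (2 * (of A).det) := by gcongr; exact hA.2 i j
      _ = 2 := by linear_combination 2 * htk
      _ ≤ 2 ^ k := le_self_pow₀ one_le_two hk0
  refine ⟨h1, (t • of A).adjugate, ?_, fun i j => ?_⟩
  · rw [mul_adjugate, det_smul, ← hk, htk, one_smul]
  · have h2 : t • A ∈ Metric.closedBall (0 : κ → κ → ℝ) 2 := by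
      rw [mem_closedBall_zero_iff, pi_norm_le_iff_of_nonneg zero_le_two]
      intro i
      rw [pi_norm_le_iff_of_nonneg zero_le_two]
      exact h1 i
    have h3 := ((norm_le_pi_norm (f (t • A) i) j).trans (norm_le_pi_norm (f (t • A)) i)).trans
      (hC _ h2)
    exact h3.trans ((le_abs_self _).trans (by linarith))

end BalancedSet

section LowerBound

open scoped ENNReal NNReal

variable {ι κ : Type*} [Fintype ι] [Fintype κ]

/-- Vectors whose first coordinate is positive, at most `ε`, and of largest absolute value. -/
def cuspVectors (κ : Type*) (ε : ℝ) : Set (Unit ⊕ κ → ℝ) :=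
  {b | 0 < b (.inl ()) ∧ b (.inl ()) ≤ ε ∧ ∀ i, |b i| ≤ b (.inl ())}

theorem measurableSet_cuspVectors (ε : ℝ) : MeasurableSet (cuspVectors κ ε) := by
  have h1 : MeasurableSet {b : Unit ⊕ κ → ℝ | 0 < b (.inl ())} :=
    measurableSet_lt (by fun_prop) (by fun_prop)
  have h2 : MeasurableSet {b : Unit ⊕ κ → ℝ | b (.inl ()) ≤ ε} :=
    measurableSet_le (by fun_prop) (by fun_prop)
  have h3 : MeasurableSet {b : Unit ⊕ κ → ℝ | ∀ i, |b i| ≤ b (.inl ())} := by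
    rw [Set.ofPred_forall]
    exact MeasurableSet.iInter fun i => measurableSet_le (by fun_prop) (by fun_prop)
  exact h1.inter (h2.inter h3)

theorem le_volume_cuspVectors {ε : ℝ} (hε : 0 < ε) :
    ENNReal.ofReal ((ε / 2) ^ (Fintype.card κ + 1)) ≤ volume (cuspVectors κ ε) := by
  have hcard : Fintype.card (Unit ⊕ κ) = Fintype.card κ + 1 := by simp [add_comm]
  have h := Real.volume_pi_closedBall (ι := Unit ⊕ κ) (Sum.elim (fun _ => 3 * ε / 4) 0)
    (r := ε / 4) (by positivity)
  rw [hcard, show 2 * (ε / 4) = ε / 2 by ring] at h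
  rw [← h]
  refine measure_mono fun b hb => ?_
  rw [mem_closedBall_iff_norm, pi_norm_le_iff_of_nonneg (by positivity)] at hb
  have h1 := abs_le.1 (hb (.inl ()))
  simp only [Pi.sub_apply, Sum.elim_inl] at h1
  refine ⟨by linarith, by linarith, ?_⟩
  rintro (⟨⟩ | i)
  · exact abs_le.2 ⟨by linarith, le_rfl⟩
  · have h2 : |b (.inr i) - 0| ≤ ε / 4 := hb (.inr i)
    rw [sub_zero] at h2
    linarith

theorem abs_sum_le_card_mul {f : κ → ℝ} {M : ℝ} (h : ∀ i, |f i| ≤ M) :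
    |∑ i, f i| ≤ Fintype.card κ * M := by
  refine (Finset.abs_sum_le_sum_abs _ _).trans
    ((Finset.sum_le_card_nsmul _ _ M fun i _ => h i).trans ?_)
  simp

variable [DecidableEq ι] [DecidableEq κ]

/-- Reduced tuples in a cuspidal neighbourhood. -/
def cuspTuples (κ : Type*) [Fintype κ] [DecidableEq κ] (ε : ℝ) : Set (Unit ⊕ κ → Unit ⊕ κ → ℝ) :=
  blockSet (cuspVectors κ ε) (balancedSet κ)

theorem measurableSet_cuspTuples (ε : ℝ) : MeasurableSet (cuspTuples κ ε) :=
  measurableSet_blockSet (measurableSet_cuspVectors ε) (measurableSet_balancedSet κ)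

theorem le_coneMeasure_cuspTuples [Nonempty κ] [Nonempty ι] (e : Unit ⊕ κ ≃ ι) {ε : ℝ}
    (hε : 0 < ε) :
    volume {A : κ → κ → ℝ | A ∈ balancedSet κ ∧
      |(of A).det| ∈ Set.Icc ((1 / 2) ^ Fintype.card ι) 1} *
        ENNReal.ofReal ((ε / 4) ^ Fintype.card ι) ≤
      coneMeasure ι (colTuple e ⁻¹' cuspTuples κ ε) := by
  have hcard := card_of_equiv_unit_sum e
  rw [coneMeasure_preimage_colTuple e (measurableSet_cuspTuples ε)]
  have hv := volume_blockSet (measurableSet_cuspVectors (κ := κ) (ε / 2)) (fun b hb => hb.1.ne')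
    (measurableSet_balancedSet κ) (fun t ht A hA => smul_mem_balancedSet ht hA)
    (measurableSet_Icc (a := (1 / 2 : ℝ) ^ Fintype.card ι) (b := 1))
  have h1 := le_volume_cuspVectors (κ := κ) (half_pos hε)
  rw [← hcard, show ε / 2 / 2 = ε / 4 by ring] at h1
  rw [mul_comm]
  refine (mul_le_mul_left h1 _).trans ?_
  rw [← hv]
  refine measure_mono ?_
  rintro A ⟨⟨hb, hr, hq⟩, hd1, hd2⟩
  have hdet : 0 < (of A).det := by
    rw [det_eq_mul_det_quotTuple hb.1.ne']
    exact mul_pos hb.1 hq.1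
  rw [abs_of_pos hdet] at hd1 hd2
  set t := (of A).det ^ (-(Fintype.card ι : ℝ)⁻¹) with ht
  have htp : 0 < t := Real.rpow_pos_of_pos hdet _
  have htd : t ^ Fintype.card ι * (of A).det = 1 := rpow_neg_inv_pow hdet Fintype.card_ne_zero
  have ht2 : t ≤ 2 := by
    refine le_of_pow_le_pow_left₀ (Fintype.card_ne_zero (α := ι)) zero_le_two ?_
    have h2 : t ^ Fintype.card ι * (1 / 2) ^ Fintype.card ι ≤ 1 :=
      (mul_le_mul_of_nonneg_left hd1 (by positivity)).trans htd.le
    rwa [← mul_pow, ← mul_div_assoc, mul_one, div_pow, div_le_one (by positivity)] at h2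
  refine ⟨⟨⟨mul_pos htp hb.1, ?_, fun i => ?_⟩, fun i => ?_, ?_⟩, hdet, hd2⟩
  · change t * A (.inl ()) (.inl ()) ≤ ε
    have := hb.2.1
    nlinarith [hb.1]
  · change |t * A _ _| ≤ t * A _ _
    rw [abs_mul, abs_of_pos htp]
    exact mul_le_mul_of_nonneg_left (hb.2.2 i) htp.le
  · change |t * A _ _| ≤ |t * A _ _| / 2
    rw [abs_mul, abs_mul, abs_of_pos htp, mul_div_assoc]
    exact mul_le_mul_of_nonneg_left (hr i) htp.le
  · rw [quotTuple_smul htp.ne']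
    exact smul_mem_balancedSet htp hq

theorem exists_eq_lowerSL {δ : SpecialLinearGroup (Unit ⊕ κ) ℤ}
    (h : ∀ i, δ.1 (.inl ()) (.inr i) = 0) (hp : 0 < δ.1 (.inl ()) (.inl ())) :
    ∃ s γ, δ = lowerSL s γ := by
  have h12 : δ.1.toBlocks₁₂ = 0 := by
    ext i j
    exact h j
  have hdet : δ.1 (.inl ()) (.inl ()) * δ.1.toBlocks₂₂.det = 1 := by
    have := δ.2
    rw [← fromBlocks_toBlocks δ.1, h12, det_fromBlocks_zero₁₂, det_unique] at this
    exact this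
  have h1 := Int.eq_one_of_mul_eq_one_right hp.le hdet
  rw [h1, one_mul] at hdet
  refine ⟨fun i => δ.1 (.inr i) (.inl ()), ⟨δ.1.toBlocks₂₂, hdet⟩, ?_⟩
  ext i j
  rcases i with ⟨⟩ | i <;> rcases j with ⟨⟩ | j
  · simpa [lowerSL] using h1
  · simpa [lowerSL] using h j
  · simp [lowerSL]
  · simp [lowerSL, toBlocks₂₂]

/-- An integer matrix moving a tuple deep in the cusp to another such tuple has bounded entries. -/
theorem exists_bound_cuspTuples (κ : Type*) [Fintype κ] [DecidableEq κ] [Nonempty κ] :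
    ∃ R ε₀ : ℝ, 0 < ε₀ ∧ ∀ ε ≤ ε₀, ∀ A ∈ cuspTuples κ ε, (of A).det = 1 →
      ∀ δ : SpecialLinearGroup (Unit ⊕ κ) ℤ, intMul δ.1 A ∈ cuspTuples κ ε →
        ∀ i j, |(δ.1 i j : ℝ)| ≤ R := by
  obtain ⟨C, hC0, hC⟩ := exists_inverse_bound κ
  set k := Fintype.card κ with hk
  have hk0 : k ≠ 0 := Fintype.card_ne_zero
  have hden : (0 : ℝ) < 1 + k * (2 * C) := by positivity
  refine ⟨1 + k * (2 * C) + k * (k * C), (1 + k * (2 * C))⁻¹, by positivity,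
    fun ε hε A hA hdet δ hδA => ?_⟩
  obtain ⟨⟨ha, haε, hb⟩, hr, hq⟩ := hA
  obtain ⟨⟨ha', haε', hb'⟩, hr', hq'⟩ := hδA
  obtain ⟨-, Y, hY, hYC⟩ := hC _ hq
  set a := A (.inl ()) (.inl ()) with ha_def
  set Q := quotTuple A with hQ
  set t := (of Q).det ^ (-(k : ℝ)⁻¹) with ht
  have htp : 0 < t := Real.rpow_pos_of_pos hq.1 _
  have htk : t ^ k * (of Q).det = 1 := rpow_neg_inv_pow hq.1 hk0
  have haQ : a * (of Q).det = 1 := by rw [← hdet, det_eq_mul_det_quotTuple ha.ne']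
  have hε1 : ε ≤ 1 := hε.trans (inv_le_one_of_one_le₀ (by
    have : 0 ≤ k * (2 * C) := by positivity
    linarith))
  have hta : t ^ k = a := mul_right_cancel₀ hq.1.ne' (htk.trans haQ.symm)
  have ht1 : t ≤ 1 := by
    rw [← pow_le_one_iff_of_nonneg htp.le hk0, hta]
    exact haε.trans hε1
  set p : ℝ := (δ.1 (.inl ()) (.inl ()) : ℝ) with hp
  set q : κ → ℝ := fun i => (δ.1 (.inl ()) (.inr i) : ℝ) with hq_def
  have hrow : ∀ j, intMul δ.1 A (.inl ()) j = p * A (.inl ()) j + ∑ i, q i * A (.inr i) j :=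
    fun j => by simp [intMul, hp, hq_def]
  set w : κ → ℝ := q ᵥ* of Q with hw
  have hwj : ∀ j, w j = intMul δ.1 A (.inl ()) (.inr j) -
      intMul δ.1 A (.inl ()) (.inl ()) * A (.inl ()) (.inr j) / a := fun j => by
    rw [hrow, hrow, ← ha_def, add_mul, add_div, mul_right_comm, mul_div_cancel_right₀ _ ha.ne',
      Finset.sum_mul, Finset.sum_div, add_sub_add_left_eq_sub, ← Finset.sum_sub_distrib]
    simp only [hw, vecMul, dotProduct, of_apply, hQ, quotTuple, ← ha_def]
    exact Finset.sum_congr rfl fun i _ => by ring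
  have hwle : ∀ j, |w j| ≤ 2 * ε := fun j => by
    rw [hwj]
    refine (abs_sub _ _).trans ?_
    have h1 := hb' (.inr j)
    have h2 : |intMul δ.1 A (.inl ()) (.inl ()) * A (.inl ()) (.inr j) / a| ≤
        intMul δ.1 A (.inl ()) (.inl ()) := by
      rw [abs_div, abs_mul, abs_of_pos ha', abs_of_pos ha, div_le_iff₀ ha]
      exact mul_le_mul_of_nonneg_left (hb _) ha'.le
    linarith
  have hqw : q = fun i => ∑ j, t * w j * Y j i := by
    have h1 : q ᵥ* ((t • of Q) * Y) = q := by rw [hY, vecMul_one]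
    rw [← vecMul_vecMul, vecMul_smul, ← hw] at h1
    rw [← h1]
    ext i
    simp [vecMul, dotProduct]
  have hq0 : ∀ i, δ.1 (.inl ()) (.inr i) = 0 := fun i => by
    have h1 : |q i| ≤ k * (2 * ε * C) := by
      rw [hqw]
      refine abs_sum_le_card_mul fun j => ?_
      rw [abs_mul, abs_mul, abs_of_pos htp]
      have h2 : t * |w j| ≤ 2 * ε := by nlinarith [hwle j, abs_nonneg (w j)]
      exact mul_le_mul h2 (hYC _ _) (abs_nonneg _) ((abs_nonneg _).trans (hwle j))
    have h2 : (k : ℝ) * (2 * ε * C) < 1 := by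
      have h3 : (1 + k * (2 * C)) * ε ≤ 1 := by
        calc _ ≤ (1 + k * (2 * C)) * (1 + k * (2 * C))⁻¹ := by gcongr
          _ = 1 := mul_inv_cancel₀ hden.ne'
      nlinarith [ha.trans_le haε]
    have h3 : |(δ.1 (.inl ()) (.inr i) : ℝ)| < 1 := h1.trans_lt h2
    rw [← Int.abs_lt_one_iff]
    exact_mod_cast h3
  have hppos : 0 < δ.1 (.inl ()) (.inl ()) := by
    have h1 := ha'
    rw [hrow] at h1
    simp only [hq_def, hq0, Int.cast_zero, zero_mul, Finset.sum_const_zero, add_zero] at h1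
    have := pos_of_mul_pos_left h1 ha.le
    rw [hp] at this
    exact_mod_cast this
  obtain ⟨s, γ, rfl⟩ := exists_eq_lowerSL hq0 hppos
  have hQ' : quotTuple (intMul (lowerSL s γ).1 A) = intMul γ.1 Q :=
    quotTuple_intMul_lowerSL s γ ha.ne'
  rw [hQ'] at hq'
  obtain ⟨h2, -⟩ := hC _ hq'
  rw [det_intMul, ← ht] at h2
  have hγ : ∀ i j, |(γ.1 i j : ℝ)| ≤ k * (2 * C) := fun i j => by
    have h3 : (γ.1.map (Int.castRingHom ℝ)) = (t • of (intMul γ.1 Q)) * Y := by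
      rw [of_intMul, ← Matrix.mul_smul, Matrix.mul_assoc, hY, Matrix.mul_one]
    have h4 : (γ.1 i j : ℝ) = ∑ l, t * intMul γ.1 Q i l * Y l j := by
      have := congrFun (congrFun h3 i) j
      rw [mul_apply] at this
      exact this
    rw [h4]
    refine abs_sum_le_card_mul fun l => ?_
    rw [abs_mul]
    exact mul_le_mul (h2 i l) (hYC _ _) (abs_nonneg _) zero_le_two
  have hs : ∀ i, |(s i : ℝ)| ≤ 1 + k * (k * C) := fun i => by
    have h3 := hr' i
    rw [intMul_lowerSL_inl, intMul_lowerSL_inr, ← ha_def, abs_of_pos ha] at h3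
    have h4 : |∑ l, (γ.1 i l : ℝ) * A (.inr l) (.inl ())| ≤ k * (k * (2 * C) * (a / 2)) := by
      refine abs_sum_le_card_mul fun l => ?_
      rw [abs_mul]
      have := hr l
      rw [abs_of_pos ha] at this
      exact mul_le_mul (hγ _ _) this (abs_nonneg _) (by positivity)
    have h5 : |(s i : ℝ) * a| ≤ a / 2 + k * (k * (2 * C) * (a / 2)) := by
      have := abs_sub (s i * a + ∑ l, (γ.1 i l : ℝ) * A (.inr l) (.inl ()))
        (∑ l, (γ.1 i l : ℝ) * A (.inr l) (.inl ()))
      rw [add_sub_cancel_right] at this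
      linarith
    rw [abs_mul, abs_of_pos ha] at h5
    refine le_of_mul_le_mul_right (h5.trans ?_) ha
    nlinarith
  have hkC : 0 ≤ (k : ℝ) * (2 * C) := by positivity
  have hkC' : 0 ≤ (k : ℝ) * (k * C) := by positivity
  rintro (⟨⟩ | i) (⟨⟩ | j)
  · simp only [lowerSL, fromBlocks_apply₁₁, one_apply_eq, Int.cast_one, abs_one]
    linarith
  · simp only [lowerSL, fromBlocks_apply₁₂, Matrix.zero_apply, Int.cast_zero, abs_zero]
    linarith
  · exact (hs i).trans (by linarith)
  · exact (hγ i j).trans (by linarith)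

theorem exists_le_measure_short [Nonempty κ] [Nonempty ι] (e : Unit ⊕ κ ≃ ι)
    {Γ : Subgroup (SpecialLinearGroup ι ℝ)} [Countable Γ] (hΓ : Γ ≤ (intSL ι).range)
    (μ : Measure (SpecialLinearGroup ι ℝ ⧸ Γ)) [IsProbabilityMeasure μ]
    (hμ : ∀ g : SpecialLinearGroup ι ℝ, Measure.map (fun x => g • x) μ = μ) :
    ∃ C : ℝ≥0∞, C ≠ 0 ∧ ∃ ε₀ : ℝ, 0 < ε₀ ∧ ∀ ε : ℝ, 0 < ε → ε ≤ ε₀ →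
      ∀ E : Set (SpecialLinearGroup ι ℝ ⧸ Γ),
      (∀ g : SpecialLinearGroup ι ℝ, ‖g.1.col (e (.inl ()))‖ ≤ ε →
        (g : SpecialLinearGroup ι ℝ ⧸ Γ) ∈ E) →
      C * ENNReal.ofReal (ε ^ Fintype.card ι) ≤ μ E := by
  obtain ⟨c, hc0, hc⟩ := exists_liftMeasure_eq hΓ μ hμ
  obtain ⟨R, ε₀, hε₀, hR⟩ := exists_bound_cuspTuples κ
  set d := Fintype.card ι with hd
  have hd0 : d ≠ 0 := Fintype.card_ne_zero
  set v := volume {A : κ → κ → ℝ | A ∈ balancedSet κ ∧ |(of A).det| ∈ Set.Icc ((1 / 2) ^ d) 1}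
    with hv
  have hv0 : v ≠ 0 := volume_balancedSet_pos
    ((pow_le_of_le_one (by norm_num) (by norm_num) hd0).trans_lt (by norm_num))
  set n := {g | g ∈ (intSL ι).range ∧ ∀ i j, |g.1 i j| ≤ R}.ncard with hn
  set M : ℝ≥0∞ := (n + 1 : ℕ) * 4 ^ d with hM
  have hM0 : M ≠ 0 := by simp [hM]
  have hMt : M ≠ ∞ := by simp only [hM]; finiteness
  refine ⟨c * v / M, ENNReal.div_ne_zero.2 ⟨mul_ne_zero (by simpa using hc0) hv0, hMt⟩, ε₀, hε₀,
    fun ε hε hεε₀ E hE => ?_⟩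
  have h1 : liftMeasure Γ μ (colTuple e ⁻¹' cuspTuples κ ε) ≤ n * μ E := by
    refine liftMeasure_le Γ μ (measurable_colTuple e (measurableSet_cuspTuples ε))
      (fun g hg => hE g ?_) (finite_bounded_intSL R) fun g hg γ hγ hgγ => ⟨hΓ hγ, ?_⟩
    · refine (pi_norm_le_iff_of_nonneg hε.le).2 fun i => ?_
      obtain ⟨j, rfl⟩ := e.surjective i
      exact (hg.1.2.2 j).trans hg.1.2.1
    · obtain ⟨δ, rfl⟩ := hΓ hγ
      intro i j
      have h2 := hR ε hεε₀ (colTuple e g) hg (det_colTuple e g) (slReindex e δ)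
        (by rw [← colTuple_mul_intSL]; exact hgγ) (e.symm j) (e.symm i)
      rw [slReindex_apply, e.apply_symm_apply, e.apply_symm_apply] at h2
      exact h2
  have h2 : c * (v * ENNReal.ofReal ((ε / 4) ^ d)) ≤ n * μ E := by
    refine le_trans ?_ h1
    rw [hc, Measure.smul_apply, ENNReal.smul_def, smul_eq_mul]
    gcongr
    exact le_coneMeasure_cuspTuples e hε
  have h3 : ENNReal.ofReal ((ε / 4) ^ d) * 4 ^ d = ENNReal.ofReal (ε ^ d) := by
    rw [← ENNReal.ofReal_ofNat 4, ← ENNReal.ofReal_pow (by norm_num),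
      ← ENNReal.ofReal_mul (by positivity), ← mul_pow, div_mul_cancel₀ _ (by norm_num)]
  rw [mul_comm, ← mul_div_assoc]
  refine ENNReal.div_le_of_le_mul ?_
  calc ENNReal.ofReal (ε ^ d) * (c * v) = c * (v * ENNReal.ofReal ((ε / 4) ^ d)) * 4 ^ d := by
        rw [← h3]; ring
    _ ≤ n * μ E * 4 ^ d := by gcongr
    _ ≤ (n + 1 : ℕ) * μ E * 4 ^ d := by gcongr; exact Nat.le_succ n
    _ = μ E * M := by rw [hM]; ring

end LowerBound

section CuspExcursions

open scoped ENNReal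

theorem congruenceSubgroupR_le_range {ι : Type*} [Fintype ι] [DecidableEq ι] (N : ℕ)
    (v : ι → ZMod N) : congruenceSubgroupR ι N v ≤ (intSL ι).range := by
  rintro _ ⟨γ, -, rfl⟩
  exact ⟨γ, rfl⟩

theorem countable_congruenceSubgroupR {ι : Type*} [Fintype ι] [DecidableEq ι] (N : ℕ)
    (v : ι → ZMod N) : Countable (congruenceSubgroupR ι N v) := by
  have : Countable (Matrix ι ι ℤ) := inferInstanceAs (Countable (ι → ι → ℤ))
  have : Countable (SpecialLinearGroup ι ℤ) := Subtype.countable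
  exact ((Set.to_countable (congruenceStabilizer ι N v : Set _)).image (intSL ι)).to_subtype

theorem intSL_mem_congruenceSubgroupR {ι : Type*} [Fintype ι] [DecidableEq ι] (N : ℕ) {i : ι}
    {γ : SpecialLinearGroup ι ℤ} (h : γ.1.col i = Pi.single i 1) :
    intSL ι γ ∈ congruenceSubgroupR ι N (Pi.single i 1) := by
  refine ⟨γ, ?_, rfl⟩
  change γ.1.map (Int.castRingHom (ZMod N)) *ᵥ Pi.single i 1 = Pi.single i 1
  rw [mulVec_single_one]
  ext j
  have := congrFun h j
  simp only [col_apply] at this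
  simp only [col_apply, map_apply, this]
  simp [Pi.single_apply]

/-- The index set `ι` with a base point split off. -/
def basePointEquiv {ι : Type*} [DecidableEq ι] (i₀ : ι) : Unit ⊕ {i // ¬ i = i₀} ≃ ι :=
  (Equiv.sumCongr (Equiv.ofUnique Unit {i // i = i₀}) (Equiv.refl _)).trans
    (Equiv.sumCompl (· = i₀))

theorem sumElim_eq_single {R : Type*} [Zero R] [One R] {m : ℕ} (n : ℕ) (hm : 0 < m) :
    (Sum.elim (fun i => if (i : ℕ) = 0 then 1 else 0) 0 : Fin m ⊕ Fin n → R) =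
      Pi.single (.inl ⟨0, hm⟩) 1 := by
  ext (i | i) <;> simp [Pi.single_apply, Fin.ext_iff]

variable {m n N : ℕ}

theorem mulVec_eq_col (hm : 0 < m) (h : SpecialLinearGroup (Fin m ⊕ Fin n) ℝ) :
    h.1.mulVec (Sum.elim (fun i => if (i : ℕ) = 0 then (1 : ℝ) else 0) 0) =
      h.1.col (.inl ⟨0, hm⟩) := by
  rw [sumElim_eq_single n hm, mulVec_single_one]

theorem exists_norm_col_le_of_le_deltaCusp (hm : 0 < m) {T : ℝ}
    {x : SpecialLinearGroup (Fin m ⊕ Fin n) ℝ ⧸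
      congruenceSubgroupR (Fin m ⊕ Fin n) N (stdE1Mod m n N)} (hx : T ≤ DeltaCusp m n N x) :
    ∃ g : SpecialLinearGroup (Fin m ⊕ Fin n) ℝ, QuotientGroup.mk g = x ∧
      ‖g.1.col (.inl ⟨0, hm⟩)‖ ≤ Real.exp (1 - T) := by
  obtain ⟨g, rfl⟩ := QuotientGroup.mk_surjective x
  obtain ⟨_, ⟨h, hh, rfl⟩, hlt⟩ :=
    exists_lt_of_lt_csSup (by exact ⟨_, g, rfl, rfl⟩) ((sub_one_lt T).trans_le hx)
  refine ⟨h, hh, ?_⟩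
  obtain ⟨c, hc, hcγ⟩ := exists_le_norm_col h (.inl ⟨0, hm⟩)
  have h1 := hc.trans_le (hcγ 1 (one_mem _))
  rw [mul_one] at h1
  rw [mulVec_eq_col hm, Real.log_inv] at hlt
  rw [← Real.log_le_iff_le_exp h1]
  linarith

theorem le_deltaCusp_of_norm_col_le (hm : 0 < m) {T : ℝ}
    {g : SpecialLinearGroup (Fin m ⊕ Fin n) ℝ}
    (hg : ‖g.1.col (.inl ⟨0, hm⟩)‖ ≤ Real.exp (-T)) :
    T ≤ DeltaCusp m n N (QuotientGroup.mk g) := by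
  obtain ⟨c, hc, hcγ⟩ := exists_le_norm_col g (.inl ⟨0, hm⟩)
  have h1 := hc.trans_le (hcγ 1 (one_mem _))
  rw [mul_one] at h1
  refine le_csSup_of_le ⟨Real.log c⁻¹, ?_⟩ ⟨g, rfl, rfl⟩ ?_
  · rintro _ ⟨h, hh, rfl⟩
    have h2 := hcγ _ (congruenceSubgroupR_le_range N _ (QuotientGroup.eq.1 hh.symm))
    rw [mul_inv_cancel_left] at h2
    rw [mulVec_eq_col hm]
    exact Real.log_le_log (inv_pos.2 (hc.trans_le h2)) (inv_anti₀ hc h2)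
  · rw [mulVec_eq_col hm, Real.log_inv, le_neg]
    exact (Real.log_le_iff_le_exp h1).2 hg

end CuspExcursions

/-- Remark 4.5(ii) of the paper: `μ{Δ ≥ T}` is comparable to `e^{-(m+n)T}` for
all sufficiently large `T`. -/
theorem measure_cusp_excursion_asymptotics (m n : ℕ) (hm : 0 < m) (hn : 0 < n)
    (N : ℕ) (hN : 0 < N)
    (μ : Measure (Matrix.SpecialLinearGroup (Fin m ⊕ Fin n) ℝ ⧸
      congruenceSubgroupR (Fin m ⊕ Fin n) N (stdE1Mod m n N)))
    (hμprob : IsProbabilityMeasure μ)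
    (hμinv : ∀ g : Matrix.SpecialLinearGroup (Fin m ⊕ Fin n) ℝ,
      Measure.map (fun x => g • x) μ = μ) :
    ∃ c₁ c₂ T₀ : ℝ, 0 < c₁ ∧ 0 < c₂ ∧ 0 < T₀ ∧ ∀ T : ℝ, T₀ ≤ T →
      c₁ * Real.exp (-((m + n : ℝ) * T)) ≤
        (μ {x | T ≤ DeltaCusp m n N x}).toReal ∧
      (μ {x | T ≤ DeltaCusp m n N x}).toReal ≤ c₂ * Real.exp (-((m + n : ℝ) * T)) := by
  set i₀ : Fin m ⊕ Fin n := .inl ⟨0, hm⟩ with hi₀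
  have : Nonempty {i // ¬ i = i₀} := ⟨.inr ⟨0, hn⟩, by simp [hi₀]⟩
  have : Nonempty (Fin m ⊕ Fin n) := ⟨i₀⟩
  have := countable_congruenceSubgroupR N (stdE1Mod m n N)
  have hrange := congruenceSubgroupR_le_range N (stdE1Mod m n N)
  obtain ⟨C₁, hC₁, ε₀, hε₀, hlow⟩ := exists_le_measure_short (basePointEquiv i₀) hrange μ hμinv
  obtain ⟨C₂, hC₂, hup⟩ := exists_measure_short_le (basePointEquiv i₀) hrange
    (fun γ hγ => by
      rw [stdE1Mod, sumElim_eq_single n hm]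
      exact intSL_mem_congruenceSubgroupR N hγ) μ hμinv
  have hcard : Fintype.card (Fin m ⊕ Fin n) = m + n := by simp
  rw [hcard] at hlow hup
  have hexp : ∀ s : ℝ, Real.exp s ^ (m + n) = Real.exp ((m + n : ℝ) * s) := fun s => by
    rw [← Real.exp_nat_mul]
    push_cast
    rfl
  have hmin : min C₁ 1 ≠ ⊤ := ((min_le_right _ _).trans_lt ENNReal.one_lt_top).ne
  refine ⟨(min C₁ 1).toReal, C₂.toReal * Real.exp (m + n) + 1, max 1 (-Real.log ε₀),
    ENNReal.toReal_pos (by simp [hC₁]) hmin, by positivity, by positivity, fun T hT => ⟨?_, ?_⟩⟩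
  · have hT' : Real.exp (-T) ≤ ε₀ :=
      (Real.le_log_iff_exp_le hε₀).1 (neg_le.1 ((le_max_right _ _).trans hT))
    have h1 := hlow _ (Real.exp_pos _) hT' {x | T ≤ DeltaCusp m n N x}
      fun g hg => le_deltaCusp_of_norm_col_le hm hg
    rw [hexp, mul_neg] at h1
    have h2 := ENNReal.toReal_mono (measure_ne_top μ _)
      ((mul_le_mul_left (min_le_left C₁ 1) _).trans h1)
    rwa [ENNReal.toReal_mul, ENNReal.toReal_ofReal (Real.exp_pos _).le] at h2
  · have h1 := hup _ (Real.exp_pos (1 - T)) {x | T ≤ DeltaCusp m n N x}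
      fun x hx => exists_norm_col_le_of_le_deltaCusp hm hx
    have h2 := ENNReal.toReal_mono (ENNReal.mul_ne_top hC₂ ENNReal.ofReal_ne_top) h1
    rw [ENNReal.toReal_mul, ENNReal.toReal_ofReal (by positivity), hexp, mul_sub, mul_one,
      sub_eq_add_neg, Real.exp_add, ← mul_assoc] at h2
    refine h2.trans ?_
    gcongr
    linarith
end

section
/- Let d ≥ 2 and N be positive integers. For every γ ∈ SL_d(ℤ), the orbit {γγ̃e_1 : γ̃ ∈ Γ_N} equals the set P_N(γe_1) of all primitive vectors w ∈ ℤ^d with w ≡ γe_1 (mod N). In particular, Γ_N acts transitively on the set of primitive vectors of ℤ^d that are congruent to e_1 modulo N. -/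
open Matrix

/-- The first standard basis vector `e₁ = (1,0,…,0)` of `ℤ^d`. -/
def stdE1 (d : ℕ) : Fin d → ℤ := fun i => if (i : ℕ) = 0 then 1 else 0

namespace Matrix

variable {ι R : Type*} [Fintype ι] [CommRing R]

theorem dvd_mulVec {m : R} {v : ι → R} (A : Matrix ι ι R) (h : ∀ i, m ∣ v i) (i : ι) :
    m ∣ (A *ᵥ v) i :=
  Finset.dvd_sum fun j _ => (h j).mul_left (A i j)

variable [DecidableEq ι]

theorem transvection_mulVec (i j : ι) (c : R) (v : ι → R) :
    transvection i j c *ᵥ v = v + Pi.single i (c * v j) := by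
  rw [transvection, add_mulVec, one_mulVec, single_mulVec]
  rfl

theorem adjugate_mul_of_det_eq_one {A : Matrix ι ι R} (hA : A.det = 1) : A.adjugate * A = 1 := by
  rw [adjugate_mul, hA, one_smul]

theorem mul_adjugate_of_det_eq_one {A : Matrix ι ι R} (hA : A.det = 1) : A * A.adjugate = 1 := by
  rw [mul_adjugate, hA, one_smul]

theorem det_adjugate_of_det_eq_one {A : Matrix ι ι R} (hA : A.det = 1) : A.adjugate.det = 1 := by
  rw [det_adjugate, hA, one_pow]

theorem dvd_mulVec_iff_of_det_eq_one {A : Matrix ι ι R} (hA : A.det = 1) {m : R} {v : ι → R} :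
    (∀ i, m ∣ (A *ᵥ v) i) ↔ ∀ i, m ∣ v i := by
  refine ⟨fun h => ?_, dvd_mulVec A⟩
  simpa [mulVec_mulVec, adjugate_mul_of_det_eq_one hA] using dvd_mulVec A.adjugate h

end Matrix

section

variable {ι : Type*} [Fintype ι]

theorem Int.mulVec_modEq {n : ℤ} {v w : ι → ℤ} (A : Matrix ι ι ℤ)
    (h : ∀ i, v i ≡ w i [ZMOD n]) (i : ι) : (A *ᵥ v) i ≡ (A *ᵥ w) i [ZMOD n] := by
  refine (Int.modEq_iff_dvd).2 ?_
  have := dvd_mulVec A (v := w - v) (fun j => (h j).dvd) i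
  rwa [mulVec_sub] at this

theorem Finset.univ_gcd_eq_one_iff {v : ι → ℤ} :
    Finset.univ.gcd v = 1 ↔ ∀ m : ℤ, (∀ i, m ∣ v i) → IsUnit m := by
  constructor
  · intro h m hm
    rw [isUnit_iff_dvd_one, ← h]
    exact Finset.dvd_gcd fun i _ => hm i
  · intro h
    rw [← Finset.normalize_gcd, normalize_eq_one]
    exact h _ fun i => Finset.gcd_dvd (Finset.mem_univ i)

variable [DecidableEq ι]

theorem exists_det_one_mulVec_single_eq_single {i₀ i : ι} (hi : i ≠ i₀) {s : ℤ} (hs : IsUnit s) :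
    ∃ A : Matrix ι ι ℤ, A.det = 1 ∧ A *ᵥ Pi.single i s = Pi.single i₀ 1 := by
  have hss : s * s = 1 := Int.isUnit_mul_self hs
  refine ⟨transvection i i₀ (-s) * transvection i₀ i s, ?_, ?_⟩
  · rw [det_mul, det_transvection_of_ne _ _ hi, det_transvection_of_ne _ _ hi.symm, one_mul]
  · rw [← mulVec_mulVec, transvection_mulVec, transvection_mulVec]
    simp [hi.symm, hss, Pi.single_neg]

/-- The special linear group over `ℤ` moves every primitive vector to a standard basis vector. -/
theorem exists_det_one_mulVec_eq_single [Nontrivial ι] (i₀ : ι) (w : ι → ℤ)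
    (hw : ∀ m : ℤ, (∀ i, m ∣ w i) → IsUnit m) :
    ∃ A : Matrix ι ι ℤ, A.det = 1 ∧ A *ᵥ w = Pi.single i₀ 1 := by
  induction hn : ∑ i, (w i).natAbs using Nat.strong_induction_on generalizing w with
  | _ n ih =>
  by_cases h : ∃ i j, i ≠ j ∧ w j ≠ 0 ∧ (w j).natAbs ≤ (w i).natAbs
  · obtain ⟨i, j, hij, hj, hle⟩ := h
    obtain ⟨c, hc⟩ : ∃ c : ℤ, (w i + c * w j).natAbs < (w i).natAbs := by
      by_cases hs : 0 ≤ w i ↔ 0 ≤ w j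
      · exact ⟨-1, by omega⟩
      · exact ⟨1, by omega⟩
    have hdet : (transvection i j c).det = 1 := det_transvection_of_ne _ _ hij c
    have hlt : ∑ k, ((transvection i j c *ᵥ w) k).natAbs < n := by
      rw [← hn, transvection_mulVec]
      refine Finset.sum_lt_sum (fun k _ => ?_) ⟨i, Finset.mem_univ i, by simpa using hc⟩
      rcases eq_or_ne k i with rfl | hk
      · simpa using hc.le
      · simp [hk]
    obtain ⟨A, hA, hAw⟩ := ih _ hlt _
      (fun m hm => hw m ((dvd_mulVec_iff_of_det_eq_one hdet).1 hm)) rfl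
    exact ⟨A * transvection i j c, by rw [det_mul, hA, hdet, one_mul], by
      rw [← mulVec_mulVec, hAw]⟩
  · push Not at h
    obtain ⟨i, hi⟩ : ∃ i, w i ≠ 0 := by
      by_contra! h0
      exact not_isUnit_zero (hw 0 fun i => by simp [h0 i])
    have hsingle : w = Pi.single i (w i) := by
      funext k
      rcases eq_or_ne k i with rfl | hk
      · simp
      · by_contra hne
        rw [Pi.single_eq_of_ne hk] at hne
        have := h i k hk.symm hne
        have := h k i hk hi
        omega
    have hu : IsUnit (w i) := hw _ fun k => by
      rw [hsingle]
      rcases eq_or_ne k i with rfl | hk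
      · simp
      · simp [hk]
    rw [hsingle]
    rcases eq_or_ne i i₀ with rfl | hne
    · obtain ⟨j, hj⟩ := exists_ne i
      obtain ⟨A, hA, hAw⟩ := exists_det_one_mulVec_single_eq_single hj.symm hu
      obtain ⟨B, hB, hBw⟩ := exists_det_one_mulVec_single_eq_single hj isUnit_one
      exact ⟨B * A, by rw [det_mul, hA, hB, one_mul], by rw [← mulVec_mulVec, hAw, hBw]⟩
    · exact exists_det_one_mulVec_single_eq_single hne hu

end

theorem stdE1_eq_single {d : ℕ} (hd : 0 < d) : stdE1 d = Pi.single ⟨0, hd⟩ 1 := by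
  funext i
  simp [stdE1, Pi.single_apply, Fin.ext_iff]

theorem exists_det_one_mulVec_stdE1_eq {d : ℕ} (hd : 2 ≤ d) {w : Fin d → ℤ}
    (hw : Finset.univ.gcd w = 1) :
    ∃ A : Matrix (Fin d) (Fin d) ℤ, A.det = 1 ∧ A *ᵥ stdE1 d = w := by
  have : Nontrivial (Fin d) := Fin.nontrivial_iff_two_le.2 hd
  obtain ⟨A, hA, hAw⟩ := exists_det_one_mulVec_eq_single ⟨0, by omega⟩ w
    (Finset.univ_gcd_eq_one_iff.1 hw)
  refine ⟨A.adjugate, det_adjugate_of_det_eq_one hA, ?_⟩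
  rw [stdE1_eq_single (by omega), ← hAw, mulVec_mulVec, adjugate_mul_of_det_eq_one hA, one_mulVec]

theorem univ_gcd_mulVec_stdE1 {d : ℕ} (hd : 0 < d) {A : Matrix (Fin d) (Fin d) ℤ}
    (hA : A.det = 1) : Finset.univ.gcd (A *ᵥ stdE1 d) = 1 := by
  refine Finset.univ_gcd_eq_one_iff.2 fun m hm => ?_
  have := (dvd_mulVec_iff_of_det_eq_one hA).1 hm ⟨0, hd⟩
  exact isUnit_iff_dvd_one.2 (by simpa [stdE1] using this)

/-- The orbit of `e₁` under `γ Γ_N` is exactly the congruence class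
`𝒫_N(γ e₁)` of primitive vectors, and in particular `Γ_N` acts transitively on
the primitive vectors of `ℤ^d` congruent to `e₁` mod `N`. -/
theorem congruence_orbit_eq_primitive_class (d : ℕ) (hd : 2 ≤ d) (N : ℕ) (hN : 0 < N)
    (γ : Matrix (Fin d) (Fin d) ℤ) (hγ : γ.det = 1) :
    ({w : Fin d → ℤ | ∃ γt : Matrix (Fin d) (Fin d) ℤ, γt.det = 1 ∧
        (∀ i, γt.mulVec (stdE1 d) i ≡ stdE1 d i [ZMOD N]) ∧
        w = (γ * γt).mulVec (stdE1 d)} =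
      {w : Fin d → ℤ | w ≠ 0 ∧ Finset.univ.gcd w = 1 ∧
        ∀ i, w i ≡ γ.mulVec (stdE1 d) i [ZMOD N]}) ∧
    (∀ v w : Fin d → ℤ,
      v ≠ 0 → Finset.univ.gcd v = 1 → (∀ i, v i ≡ stdE1 d i [ZMOD N]) →
      w ≠ 0 → Finset.univ.gcd w = 1 → (∀ i, w i ≡ stdE1 d i [ZMOD N]) →
      ∃ γt : Matrix (Fin d) (Fin d) ℤ, γt.det = 1 ∧
        (∀ i, γt.mulVec (stdE1 d) i ≡ stdE1 d i [ZMOD N]) ∧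
        γt.mulVec v = w) := by
  constructor
  · ext w
    constructor
    · rintro ⟨γt, hdet, hmod, rfl⟩
      have hgcd := univ_gcd_mulVec_stdE1 (d := d) (by omega)
        (show (γ * γt).det = 1 by rw [det_mul, hγ, hdet, one_mul])
      refine ⟨fun h0 => ?_, hgcd, fun i => ?_⟩
      · exact zero_ne_one ((Finset.gcd_eq_zero_iff.2 fun i _ => congrFun h0 i).symm.trans hgcd)
      · rw [← mulVec_mulVec]
        exact Int.mulVec_modEq γ hmod i
    · rintro ⟨-, hgcd, hmod⟩
      obtain ⟨A, hA, rfl⟩ := exists_det_one_mulVec_stdE1_eq hd hgcd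
      refine ⟨γ.adjugate * A, ?_, fun i => ?_, ?_⟩
      · rw [det_mul, det_adjugate_of_det_eq_one hγ, hA, one_mul]
      · have := Int.mulVec_modEq γ.adjugate hmod i
        rwa [mulVec_mulVec, mulVec_mulVec, adjugate_mul_of_det_eq_one hγ, one_mulVec] at this
      · rw [← Matrix.mul_assoc, mul_adjugate_of_det_eq_one hγ, Matrix.one_mul]
  · intro v w _ hv hvmod _ hw hwmod
    obtain ⟨A, hA, rfl⟩ := exists_det_one_mulVec_stdE1_eq hd hv
    obtain ⟨B, hB, rfl⟩ := exists_det_one_mulVec_stdE1_eq hd hw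
    refine ⟨B * A.adjugate, ?_, fun i => ?_, ?_⟩
    · rw [det_mul, hB, det_adjugate_of_det_eq_one hA, one_mul]
    · have hAmod := Int.mulVec_modEq A.adjugate hvmod
      simp only [mulVec_mulVec, adjugate_mul_of_det_eq_one hA, one_mulVec] at hAmod
      rw [← mulVec_mulVec]
      exact (Int.mulVec_modEq B (fun j => (hAmod j).symm) i).trans (hwmod i)
    · rw [mulVec_mulVec, Matrix.mul_assoc, adjugate_mul_of_det_eq_one hA, Matrix.mul_one]
end
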